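/- arXiv:math/0610102 — 2 statements merged into one kernel-verified Lean document; each statement's English description precedes it below -/
import Mathlib

section
/- If u ∈ L^∞_loc(Ω) is nonnegative a.e. and a subsolution of −Δu + |u|^{q−1}u = 0, and v ∈ L^∞_loc(Ω) is nonnegative a.e. and a supersolution of the same equation, then the function (u − v)_+ := max(u − v, 0) is a subsolution of the equation in Ω. -/
open MeasureTheory Set Filter

noncomputable section

def laplacian {N : ℕ} (φ : EuclideanSpace ℝ (Fin N) → ℝ) (x : EuclideanSpace ℝ (Fin N)) : ℝ :=
  ∑ i : Fin N, iteratedFDeriv ℝ 2 φ x ![EuclideanSpace.single i 1, EuclideanSpace.single i 1]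

def IsTestFun {N : ℕ} (Ω : Set (EuclideanSpace ℝ (Fin N))) (φ : EuclideanSpace ℝ (Fin N) → ℝ) : Prop :=
  ContDiff ℝ (⊤ : ℕ∞) φ ∧ HasCompactSupport φ ∧ tsupport φ ⊆ Ω

def MemLqLoc {N : ℕ} (q : ℝ) (Ω : Set (EuclideanSpace ℝ (Fin N)))
    (u : EuclideanSpace ℝ (Fin N) → ℝ) : Prop :=
  AEStronglyMeasurable u (volume.restrict Ω) ∧
  ∀ K : Set (EuclideanSpace ℝ (Fin N)), K ⊆ Ω → IsCompact K →
    IntegrableOn (fun x => |u x| ^ q) K volume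

def MemLinftyLoc {N : ℕ} (Ω : Set (EuclideanSpace ℝ (Fin N)))
    (u : EuclideanSpace ℝ (Fin N) → ℝ) : Prop :=
  AEStronglyMeasurable u (volume.restrict Ω) ∧
  ∀ K : Set (EuclideanSpace ℝ (Fin N)), K ⊆ Ω → IsCompact K →
    ∃ M : ℝ, ∀ᵐ x ∂(volume.restrict K), |u x| ≤ M

def IsSubsolution {N : ℕ} (q : ℝ) (Ω : Set (EuclideanSpace ℝ (Fin N)))
    (u : EuclideanSpace ℝ (Fin N) → ℝ) : Prop :=
  MemLqLoc q Ω u ∧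
  ∀ φ : EuclideanSpace ℝ (Fin N) → ℝ, IsTestFun Ω φ → (∀ x, 0 ≤ φ x) →
    (∫ x in Ω, (-(u x) * laplacian φ x + |u x| ^ (q - 1) * u x * φ x)) ≤ 0

def IsSupersolution {N : ℕ} (q : ℝ) (Ω : Set (EuclideanSpace ℝ (Fin N)))
    (u : EuclideanSpace ℝ (Fin N) → ℝ) : Prop :=
  MemLqLoc q Ω u ∧
  ∀ φ : EuclideanSpace ℝ (Fin N) → ℝ, IsTestFun Ω φ → (∀ x, 0 ≤ φ x) →
    0 ≤ (∫ x in Ω, (-(u x) * laplacian φ x + |u x| ^ (q - 1) * u x * φ x))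

def IsSolution {N : ℕ} (q : ℝ) (Ω : Set (EuclideanSpace ℝ (Fin N)))
    (u : EuclideanSpace ℝ (Fin N) → ℝ) : Prop :=
  MemLqLoc q Ω u ∧
  ∀ φ : EuclideanSpace ℝ (Fin N) → ℝ, IsTestFun Ω φ →
    (∫ x in Ω, (-(u x) * laplacian φ x + |u x| ^ (q - 1) * u x * φ x)) = 0

section Laplacian

variable {N : ℕ}

lemma contDiff_fderiv_apply_const {E : Type*} [NormedAddCommGroup E] [NormedSpace ℝ E]
    {g : E → ℝ} (hg : ContDiff ℝ (⊤ : ℕ∞) g) (e : E) :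
    ContDiff ℝ (⊤ : ℕ∞) (fun x => fderiv ℝ g x e) :=
  (hg.fderiv_right (m := (⊤ : ℕ∞)) (by simp)).clm_apply contDiff_const

lemma laplacian_eq_sum_fderiv {g : EuclideanSpace ℝ (Fin N) → ℝ}
    (hg : ContDiff ℝ (⊤ : ℕ∞) g) (x : EuclideanSpace ℝ (Fin N)) :
    laplacian g x = ∑ i : Fin N,
      fderiv ℝ (fun y => fderiv ℝ g y (EuclideanSpace.single i 1)) x
        (EuclideanSpace.single i 1) := by
  unfold laplacian
  refine Finset.sum_congr rfl fun i _ => ?_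
  have h : DifferentiableAt ℝ (fderiv ℝ g) x :=
    (hg.fderiv_right (m := (⊤ : ℕ∞)) (by simp)).differentiable (by simp) x
  rw [iteratedFDeriv_two_apply, fderiv_clm_apply h (differentiableAt_const _)]
  simp

lemma contDiff_laplacian {g : EuclideanSpace ℝ (Fin N) → ℝ}
    (hg : ContDiff ℝ (⊤ : ℕ∞) g) : ContDiff ℝ (⊤ : ℕ∞) (laplacian g) := by
  rw [funext (laplacian_eq_sum_fderiv hg)]
  exact ContDiff.sum fun i _ =>
    contDiff_fderiv_apply_const (contDiff_fderiv_apply_const hg _) _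

lemma support_laplacian_subset (g : EuclideanSpace ℝ (Fin N) → ℝ) :
    Function.support (laplacian g) ⊆ tsupport g := by
  intro x hx
  by_contra h
  refine hx ?_
  have : iteratedFDeriv ℝ 2 g x = 0 := by
    by_contra h'
    exact h (support_iteratedFDeriv_subset (𝕜 := ℝ) 2 h')
  simp [laplacian, this]

lemma integral_fderiv_mul_eq_neg {E : Type*} [NormedAddCommGroup E] [NormedSpace ℝ E]
    [FiniteDimensional ℝ E] [MeasurableSpace E] [BorelSpace E] (μ : Measure E)
    [μ.IsAddHaarMeasure] {g φ : E → ℝ} (hg : ContDiff ℝ (⊤ : ℕ∞) g)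
    (hφ : ContDiff ℝ (⊤ : ℕ∞) φ) (hc : HasCompactSupport φ) (e : E) :
    ∫ x, g x * fderiv ℝ φ x e ∂μ = -∫ x, fderiv ℝ g x e * φ x ∂μ := by
  have hc' : HasCompactSupport fun x => fderiv ℝ φ x e := hc.fderiv_apply (𝕜 := ℝ) e
  refine integral_mul_fderiv_eq_neg_fderiv_mul_of_integrable ?_ ?_ ?_
    (fun x _ => hg.differentiable (by simp) x) (fun x _ => hφ.differentiable (by simp) x)
  · exact ((contDiff_fderiv_apply_const hg e).continuous.mul hφ.continuous
      ).integrable_of_hasCompactSupport hc.mul_left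
  · exact (hg.continuous.mul (contDiff_fderiv_apply_const hφ e).continuous
      ).integrable_of_hasCompactSupport hc'.mul_left
  · exact (hg.continuous.mul hφ.continuous).integrable_of_hasCompactSupport hc.mul_left

lemma integral_mul_laplacian {g φ : EuclideanSpace ℝ (Fin N) → ℝ}
    (hg : ContDiff ℝ (⊤ : ℕ∞) g) (hφ : ContDiff ℝ (⊤ : ℕ∞) φ) (hc : HasCompactSupport φ) :
    ∫ x, g x * laplacian φ x = ∫ x, laplacian g x * φ x := by
  simp_rw [laplacian_eq_sum_fderiv hg, laplacian_eq_sum_fderiv hφ, Finset.mul_sum,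
    Finset.sum_mul]
  have hD := fun e => contDiff_fderiv_apply_const hφ e
  have hcD : ∀ e, HasCompactSupport fun x => fderiv ℝ φ x e :=
    fun e => hc.fderiv_apply (𝕜 := ℝ) e
  rw [integral_finsetSum, integral_finsetSum]
  · refine Finset.sum_congr rfl fun i _ => ?_
    rw [integral_fderiv_mul_eq_neg volume hg (hD _) (hcD _),
      integral_fderiv_mul_eq_neg volume (contDiff_fderiv_apply_const hg _) hφ hc, neg_neg]
  · intro i _
    exact ((contDiff_fderiv_apply_const (contDiff_fderiv_apply_const hg _) _).continuous.mul
      hφ.continuous).integrable_of_hasCompactSupport hc.mul_left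
  · intro i _
    exact (hg.continuous.mul (contDiff_fderiv_apply_const (hD _) _).continuous
      ).integrable_of_hasCompactSupport ((hcD _).fderiv_apply (𝕜 := ℝ) _).mul_left

lemma mul_laplacian_le_laplacian_comp {p p' p'' : ℝ → ℝ} (hp : ContDiff ℝ (⊤ : ℕ∞) p)
    (hp' : ∀ t, HasDerivAt p (p' t) t) (hp'' : ∀ t, HasDerivAt p' (p'' t) t)
    (hpos : ∀ t, 0 ≤ p'' t) {g : EuclideanSpace ℝ (Fin N) → ℝ}
    (hg : ContDiff ℝ (⊤ : ℕ∞) g) (x : EuclideanSpace ℝ (Fin N)) :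
    p' (g x) * laplacian g x ≤ laplacian (fun y => p (g y)) x := by
  rw [laplacian_eq_sum_fderiv hg, laplacian_eq_sum_fderiv (g := fun y => p (g y)) (hp.comp hg), Finset.mul_sum]
  refine Finset.sum_le_sum fun i _ => ?_
  set e : EuclideanSpace ℝ (Fin N) := EuclideanSpace.single i 1
  have hgd : ∀ y, HasFDerivAt g (fderiv ℝ g y) y := fun y =>
    (hg.differentiable (by simp) y).hasFDerivAt
  have h1 : (fun y => fderiv ℝ (fun z => p (g z)) y e) =
      fun y => p' (g y) * fderiv ℝ g y e := by
    funext y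
    have h : fderiv ℝ (fun z => p (g z)) y = _ := ((hp' (g y)).comp_hasFDerivAt y (hgd y)).fderiv
    rw [h]
    simp
  have h2 : HasFDerivAt (fun y => fderiv ℝ g y e)
      (fderiv ℝ (fun y => fderiv ℝ g y e) x) x :=
    ((contDiff_fderiv_apply_const hg e).differentiable (by simp) x).hasFDerivAt
  have h3 := ((hp'' (g x)).comp_hasFDerivAt x (hgd x)).mul h2
  have h4 : fderiv ℝ (fun y => p' (g y) * fderiv ℝ g y e) x = _ := h3.fderiv
  rw [h1, h4]
  have := mul_nonneg (hpos (g x)) (mul_self_nonneg (fderiv ℝ g x e))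
  simp only [_root_.add_apply, _root_.smul_apply, smul_eq_mul,
    Function.comp]
  nlinarith

end Laplacian

section Mollification

open scoped Convolution

variable {E : Type*} [NormedAddCommGroup E] [NormedSpace ℝ E] [FiniteDimensional ℝ E]
  [MeasurableSpace E] [BorelSpace E] {μ : Measure E} [μ.IsAddHaarMeasure]

lemma convolution_lsmul_eq_integral (ρ W : E → ℝ) (x : E) :
    (ρ ⋆[ContinuousLinearMap.lsmul ℝ ℝ, μ] W) x = ∫ t, ρ (x - t) * W t ∂μ := by
  rw [convolution_eq_swap]
  rfl

lemma contDiff_integral_sub_mul {ρ W : E → ℝ} (hρ : ContDiff ℝ (⊤ : ℕ∞) ρ)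
    (hc : HasCompactSupport ρ) (hW : LocallyIntegrable W μ) :
    ContDiff ℝ (⊤ : ℕ∞) (fun x => ∫ t, ρ (x - t) * W t ∂μ) := by
  have := hc.contDiff_convolution_left (n := ⊤) (ContinuousLinearMap.lsmul ℝ ℝ) hρ hW
  rwa [funext (convolution_lsmul_eq_integral (μ := μ) ρ W)] at this

lemma fderiv_integral_sub_mul {ρ W : E → ℝ} (hρ : ContDiff ℝ (⊤ : ℕ∞) ρ)
    (hc : HasCompactSupport ρ) (hW : LocallyIntegrable W μ) (x e : E) :
    fderiv ℝ (fun x => ∫ t, ρ (x - t) * W t ∂μ) x e =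
      ∫ t, fderiv ℝ ρ (x - t) e * W t ∂μ := by
  have h := hc.hasFDerivAt_convolution_left (ContinuousLinearMap.lsmul ℝ ℝ)
    (hρ.of_le (by simp)) hW x
  rw [funext (convolution_lsmul_eq_integral (μ := μ) ρ W)] at h
  have hex : ConvolutionExistsAt (fderiv ℝ ρ) W x
      ((ContinuousLinearMap.lsmul ℝ ℝ : ℝ →L[ℝ] ℝ →L[ℝ] ℝ).precompL E) μ :=
    (hc.fderiv ℝ).convolutionExists_left _
      (hρ.continuous_fderiv (by simp)) hW x
  rw [h.fderiv, convolution_eq_swap, ContinuousLinearMap.integral_apply hex.integrable_swap]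
  simp [ContinuousLinearMap.precompL_apply]

end Mollification

lemma laplacian_integral_sub_mul {N : ℕ} {ρ W : EuclideanSpace ℝ (Fin N) → ℝ}
    (hρ : ContDiff ℝ (⊤ : ℕ∞) ρ) (hc : HasCompactSupport ρ) (hW : LocallyIntegrable W)
    (x : EuclideanSpace ℝ (Fin N)) :
    laplacian (fun x => ∫ t, ρ (x - t) * W t) x = ∫ t, W t * laplacian ρ (x - t) := by
  rw [laplacian_eq_sum_fderiv (contDiff_integral_sub_mul hρ hc hW)]
  simp_rw [laplacian_eq_sum_fderiv hρ, Finset.mul_sum]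
  have hD := fun e => contDiff_fderiv_apply_const hρ e
  have hcD : ∀ e, HasCompactSupport fun x => fderiv ℝ ρ x e :=
    fun e => hc.fderiv_apply (𝕜 := ℝ) e
  rw [integral_finsetSum]
  · refine Finset.sum_congr rfl fun i _ => ?_
    simp_rw [fderiv_integral_sub_mul hρ hc hW]
    rw [fderiv_integral_sub_mul (hD _) (hcD _) hW]
    simp_rw [mul_comm]
  · intro i _
    have := ((hcD (EuclideanSpace.single i 1)).fderiv_apply (𝕜 := ℝ)
      (EuclideanSpace.single i 1)).convolutionExists_left (ContinuousLinearMap.lsmul ℝ ℝ)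
      (contDiff_fderiv_apply_const (hD _) _).continuous hW x
    simpa [mul_comm] using this.integrable_swap

lemma laplacian_comp_const_sub {N : ℕ} {ρ : EuclideanSpace ℝ (Fin N) → ℝ}
    (hρ : ContDiff ℝ (⊤ : ℕ∞) ρ) (x t : EuclideanSpace ℝ (Fin N)) :
    laplacian (fun t => ρ (x - t)) t = laplacian ρ (x - t) := by
  have key : ∀ {f : EuclideanSpace ℝ (Fin N) → ℝ} (_ : ContDiff ℝ (⊤ : ℕ∞) f) s e,
      fderiv ℝ (fun t => f (x - t)) s e = - fderiv ℝ f (x - s) e := by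
    intro f hf s e
    have h : HasFDerivAt (fun t => x - t)
        (-ContinuousLinearMap.id ℝ (EuclideanSpace ℝ (Fin N))) s :=
      (hasFDerivAt_id s).const_sub x
    have h' := ((hf.differentiable (by simp) (x - s)).hasFDerivAt).comp s h
    have h4 : fderiv ℝ (fun t => f (x - t)) s = _ := h'.fderiv
    rw [h4]
    simp
  rw [laplacian_eq_sum_fderiv (g := fun t => ρ (x - t)) (hρ.comp (contDiff_const.sub contDiff_id)),
    laplacian_eq_sum_fderiv hρ]
  refine Finset.sum_congr rfl fun i _ => ?_
  simp_rw [key hρ]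
  rw [fderiv_fun_neg, _root_.neg_apply, key (contDiff_fderiv_apply_const hρ _), neg_neg]

lemma abs_integral_sub_mul_le {E : Type*} [NormedAddCommGroup E] [NormedSpace ℝ E]
    [FiniteDimensional ℝ E] [MeasurableSpace E] [BorelSpace E] {μ : Measure E}
    [μ.IsAddHaarMeasure] {ρ W : E → ℝ} (hρ : Integrable ρ μ) (hρ0 : ∀ t, 0 ≤ ρ t)
    (hρ1 : ∫ t, ρ t ∂μ = 1) {M : ℝ} (hW : ∀ᵐ t ∂μ, |W t| ≤ M) (x : E) :
    |∫ t, ρ (x - t) * W t ∂μ| ≤ M := by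
  have h : ‖∫ t, ρ (x - t) * W t ∂μ‖ ≤ ∫ t, ρ (x - t) * M ∂μ := by
    refine norm_integral_le_of_norm_le ((hρ.comp_sub_left x).mul_const M) ?_
    filter_upwards [hW] with t ht
    rw [norm_mul, Real.norm_of_nonneg (hρ0 _)]
    exact mul_le_mul_of_nonneg_left ht (hρ0 _)
  rwa [integral_mul_const, integral_sub_left_eq_self ρ μ x, hρ1, one_mul] at h

section SmoothPosPart

/-- A smooth convex approximation of the positive part `max t 0`. -/
def smoothPosPart (η t : ℝ) : ℝ := (√(t ^ 2 + η ^ 2) + t) / 2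

/-- The derivative of `smoothPosPart η`. -/
def smoothPosPartDeriv (η t : ℝ) : ℝ := (t / √(t ^ 2 + η ^ 2) + 1) / 2

variable {η : ℝ}

lemma contDiff_smoothPosPart (hη : 0 < η) : ContDiff ℝ (⊤ : ℕ∞) (smoothPosPart η) := by
  unfold smoothPosPart
  refine ((ContDiff.sqrt (by fun_prop) fun t => ?_).add contDiff_id).div_const 2
  positivity

lemma hasDerivAt_sqrt_sq_add_sq (hη : 0 < η) (t : ℝ) :
    HasDerivAt (fun t => √(t ^ 2 + η ^ 2)) (t / √(t ^ 2 + η ^ 2)) t := by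
  have h : HasDerivAt (fun t : ℝ => t ^ 2 + η ^ 2) (2 * t) t := by
    simpa using (hasDerivAt_pow 2 t).add_const (η ^ 2)
  have h0 : t ^ 2 + η ^ 2 ≠ 0 := by positivity
  convert h.sqrt h0 using 1
  field_simp

lemma hasDerivAt_smoothPosPart (hη : 0 < η) (t : ℝ) :
    HasDerivAt (smoothPosPart η) (smoothPosPartDeriv η t) t :=
  ((hasDerivAt_sqrt_sq_add_sq hη t).add (hasDerivAt_id t)).div_const 2

lemma hasDerivAt_smoothPosPartDeriv (hη : 0 < η) (t : ℝ) :
    HasDerivAt (smoothPosPartDeriv η) (η ^ 2 / (2 * √(t ^ 2 + η ^ 2) ^ 3)) t := by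
  have h0 : 0 < √(t ^ 2 + η ^ 2) := Real.sqrt_pos.2 (by positivity)
  have hsq : √(t ^ 2 + η ^ 2) ^ 2 = t ^ 2 + η ^ 2 := Real.sq_sqrt (by positivity)
  have h := (((hasDerivAt_id t).div (hasDerivAt_sqrt_sq_add_sq hη t) h0.ne').add_const 1).div_const 2
  refine HasDerivAt.congr_deriv h ?_
  simp only [id]
  field_simp
  rw [hsq]
  ring

lemma abs_smoothPosPart_le (hη : 0 ≤ η) (t : ℝ) : |smoothPosPart η t| ≤ |t| + η := by
  have h : √(t ^ 2 + η ^ 2) ≤ |t| + η := by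
    refine Real.sqrt_le_iff.2 ⟨by positivity, ?_⟩
    nlinarith [sq_abs t, mul_nonneg (abs_nonneg t) hη]
  have := Real.sqrt_nonneg (t ^ 2 + η ^ 2)
  unfold smoothPosPart
  rw [abs_le]
  constructor <;> linarith [le_abs_self t, neg_abs_le t]

lemma smoothPosPartDeriv_mem_Icc (η t : ℝ) : smoothPosPartDeriv η t ∈ Icc (0 : ℝ) 1 := by
  have h : |t / √(t ^ 2 + η ^ 2)| ≤ 1 := by
    rw [abs_div, abs_of_nonneg (Real.sqrt_nonneg _)]
    exact div_le_one_of_le₀ (Real.abs_le_sqrt (by nlinarith [sq_nonneg η])) (Real.sqrt_nonneg _)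
  have := abs_le.1 h
  unfold smoothPosPartDeriv
  constructor <;> linarith

lemma tendsto_smoothPosPart {ι : Type*} {l : Filter ι} {η s : ι → ℝ} {t : ℝ}
    (hη : Tendsto η l (nhds 0)) (hs : Tendsto s l (nhds t)) :
    Tendsto (fun i => smoothPosPart (η i) (s i)) l (nhds (max t 0)) := by
  have h := ((((hs.pow 2).add (hη.pow 2)).sqrt).add hs).div_const 2
  refine (congrArg (fun a => Tendsto _ l (nhds a)) ?_).mp h
  rw [zero_pow two_ne_zero, add_zero, Real.sqrt_sq_eq_abs]
  rcases le_total 0 t with ht | ht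
  · rw [max_eq_left ht, abs_of_nonneg ht]; ring
  · rw [max_eq_right ht, abs_of_nonpos ht]; ring

lemma tendsto_smoothPosPartDeriv_mul {ι : Type*} {l : Filter ι} {η s f : ι → ℝ} {t a : ℝ}
    (hη : Tendsto η l (nhds 0)) (hs : Tendsto s l (nhds t)) (hf : Tendsto f l (nhds a))
    (ha : t = 0 → a = 0) :
    Tendsto (fun i => smoothPosPartDeriv (η i) (s i) * f i) l
      (nhds (if 0 < t then a else 0)) := by
  rcases eq_or_ne t 0 with rfl | ht
  · rw [if_neg (lt_irrefl _)]
    rw [ha rfl] at hf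
    refine squeeze_zero_norm (fun i => ?_) (tendsto_zero_iff_norm_tendsto_zero.1 hf)
    have h := smoothPosPartDeriv_mem_Icc (η i) (s i)
    rw [norm_mul, Real.norm_of_nonneg h.1]
    exact mul_le_of_le_one_left (norm_nonneg _) h.2
  · have h0 : √(t ^ 2 + 0 ^ 2) ≠ 0 := by simpa [Real.sqrt_sq_eq_abs] using ht
    have h := (((hs.div (((hs.pow 2).add (hη.pow 2)).sqrt) h0).add_const 1).div_const 2).mul hf
    refine (congrArg (fun a => Tendsto _ l (nhds a)) ?_).mp h
    rw [zero_pow two_ne_zero, add_zero, Real.sqrt_sq_eq_abs]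
    rcases ht.lt_or_gt with ht' | ht'
    · rw [if_neg ht'.not_gt, abs_of_neg ht', div_neg, div_self ht]; ring
    · rw [if_pos ht', abs_of_pos ht', div_self ht]; ring

end SmoothPosPart

section Kato

variable {N : ℕ} {Ω : Set (EuclideanSpace ℝ (Fin N))}

lemma MemLinftyLoc.exists_ae_abs_indicator_le {w : EuclideanSpace ℝ (Fin N) → ℝ}
    (hw : MemLinftyLoc Ω w) {K : Set (EuclideanSpace ℝ (Fin N))} (hK : IsCompact K)
    (hKΩ : K ⊆ Ω) : ∃ M, ∀ᵐ x, |K.indicator w x| ≤ M := by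
  obtain ⟨M, hM⟩ := hw.2 K hKΩ hK
  rw [ae_restrict_iff' hK.measurableSet] at hM
  refine ⟨max M 0, ?_⟩
  filter_upwards [hM] with x hx
  by_cases h : x ∈ K
  · rw [indicator_of_mem h]
    exact (hx h).trans (le_max_left _ _)
  · simp [indicator_of_notMem h]

lemma MemLinftyLoc.integrable_indicator {w : EuclideanSpace ℝ (Fin N) → ℝ}
    (hw : MemLinftyLoc Ω w) {K : Set (EuclideanSpace ℝ (Fin N))} (hK : IsCompact K)
    (hKΩ : K ⊆ Ω) : Integrable (K.indicator w) := by
  obtain ⟨M, hM⟩ := hw.2 K hKΩ hK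
  rw [integrable_indicator_iff hK.measurableSet]
  exact IntegrableOn.of_bound hK.measure_lt_top (hw.1.mono_set hKΩ) M hM

lemma integrable_mul_continuous_of_hasCompactSupport {W φ : EuclideanSpace ℝ (Fin N) → ℝ}
    (hW : Integrable W) (hφ : Continuous φ) (hc : HasCompactSupport φ) :
    Integrable (fun x => W x * φ x) := by
  obtain ⟨C, hC⟩ := hφ.bounded_above_of_compact_support hc
  exact hW.mul_bdd (c := C) hφ.aestronglyMeasurable (Eventually.of_forall hC)

lemma setIntegral_eq_integral_indicator {w f φ : EuclideanSpace ℝ (Fin N) → ℝ}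
    {K : Set (EuclideanSpace ℝ (Fin N))} (hKΩ : K ⊆ Ω) (hφ : tsupport φ ⊆ K) :
    ∫ x in Ω, (-(w x) * laplacian φ x + f x * φ x) =
      ∫ x, (-(K.indicator w x) * laplacian φ x + K.indicator f x * φ x) := by
  have hz : ∀ x ∉ K, laplacian φ x = 0 ∧ φ x = 0 := fun x hx =>
    ⟨by_contra fun h => hx (hφ (support_laplacian_subset φ h)),
      image_eq_zero_of_notMem_tsupport fun h => hx (hφ h)⟩
  rw [setIntegral_eq_integral_of_forall_compl_eq_zero]
  · congr 1 with x
    by_cases hx : x ∈ K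
    · simp [hx]
    · simp [hz x hx]
  · intro x hx
    simp [hz x fun h => hx (hKΩ h)]

lemma le_laplacian_integral_sub_mul {w f ρ : EuclideanSpace ℝ (Fin N) → ℝ}
    (hw : MemLinftyLoc Ω w) (hf : MemLinftyLoc Ω f)
    (h : ∀ φ : EuclideanSpace ℝ (Fin N) → ℝ, IsTestFun Ω φ → (∀ x, 0 ≤ φ x) →
      (∫ x in Ω, (-(w x) * laplacian φ x + f x * φ x)) ≤ 0)
    {K : Set (EuclideanSpace ℝ (Fin N))} (hK : IsCompact K) (hKΩ : K ⊆ Ω)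
    (hρ : ContDiff ℝ (⊤ : ℕ∞) ρ) (hc : HasCompactSupport ρ) (hρ0 : ∀ t, 0 ≤ ρ t)
    {x : EuclideanSpace ℝ (Fin N)} (hx : ∀ t, x - t ∈ tsupport ρ → t ∈ K) :
    ∫ t, ρ (x - t) * K.indicator f t ≤
      laplacian (fun x => ∫ t, ρ (x - t) * K.indicator w t) x := by
  have hW := hw.integrable_indicator hK hKΩ
  have hF := hf.integrable_indicator hK hKΩ
  have hψ : ContDiff ℝ (⊤ : ℕ∞) (fun t => ρ (x - t)) :=
    hρ.comp (contDiff_const.sub contDiff_id)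
  have hψK : tsupport (fun t => ρ (x - t)) ⊆ K :=
    (tsupport_comp_subset_preimage ρ (by fun_prop : Continuous fun t => x - t)).trans hx
  have hψc : HasCompactSupport (fun t => ρ (x - t)) :=
    HasCompactSupport.of_support_subset_isCompact hK ((subset_tsupport _).trans hψK)
  have hle := h _ ⟨hψ, hψc, hψK.trans hKΩ⟩ fun t => hρ0 _
  have hLc : HasCompactSupport (laplacian fun t => ρ (x - t)) :=
    HasCompactSupport.of_support_subset_isCompact hψc (support_laplacian_subset _)
  rw [setIntegral_eq_integral_indicator hKΩ hψK, integral_add] at hle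
  · rw [laplacian_integral_sub_mul hρ hc hW.locallyIntegrable]
    simp_rw [laplacian_comp_const_sub hρ, neg_mul, integral_neg] at hle
    simp_rw [mul_comm (ρ _)]
    linarith
  · exact integrable_mul_continuous_of_hasCompactSupport hW.neg (contDiff_laplacian hψ).continuous hLc
  · exact integrable_mul_continuous_of_hasCompactSupport hF hψ.continuous hψc

/-- **Kato's inequality** for locally bounded functions: if `f ≤ Δ w` weakly, then
`1_{w > 0} f ≤ Δ w₊` weakly. -/
lemma kato_inequality (hΩ : IsOpen Ω) {w f : EuclideanSpace ℝ (Fin N) → ℝ}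
    (hw : MemLinftyLoc Ω w) (hf : MemLinftyLoc Ω f) (hwf : ∀ x, w x = 0 → f x = 0)
    (h : ∀ φ : EuclideanSpace ℝ (Fin N) → ℝ, IsTestFun Ω φ → (∀ x, 0 ≤ φ x) →
      (∫ x in Ω, (-(w x) * laplacian φ x + f x * φ x)) ≤ 0)
    {φ : EuclideanSpace ℝ (Fin N) → ℝ} (hφ : IsTestFun Ω φ) (hφ0 : ∀ x, 0 ≤ φ x) :
    (∫ x in Ω, (-(max (w x) 0) * laplacian φ x + (if 0 < w x then f x else 0) * φ x)) ≤ 0 := by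
  obtain ⟨hφs, hφc, hφΩ⟩ := hφ
  obtain ⟨δ, hδ, hKΩ⟩ := IsCompact.exists_cthickening_subset_open hφc hΩ hφΩ
  set K := Metric.cthickening δ (tsupport φ)
  have hK : IsCompact K := IsCompact.cthickening hφc
  have hφK : tsupport φ ⊆ K := Metric.self_subset_cthickening _
  have hW := hw.integrable_indicator hK hKΩ
  have hF := hf.integrable_indicator hK hKΩ
  obtain ⟨A, hA⟩ := hw.exists_ae_abs_indicator_le hK hKΩ
  obtain ⟨B, hB⟩ := hf.exists_ae_abs_indicator_le hK hKΩ
  set W := K.indicator w with hWdef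
  set F := K.indicator f with hFdef
  have hWF : ∀ x, W x = 0 → F x = 0 := fun x hx => by
    by_cases hxK : x ∈ K
    · rw [hFdef, indicator_of_mem hxK]
      rw [hWdef, indicator_of_mem hxK] at hx
      exact hwf x hx
    · rw [hFdef, indicator_of_notMem hxK]
  have hLc : HasCompactSupport (laplacian φ) :=
    HasCompactSupport.of_support_subset_isCompact hφc (support_laplacian_subset _)
  have hLs := contDiff_laplacian hφs
  let η : ℕ → ℝ := fun n => 1 / ((n : ℝ) + 1)
  have hη0 : ∀ n, 0 < η n := fun n => by positivity
  have hη1 : ∀ n, η n ≤ 1 := fun n => by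
    refine div_le_one_of_le₀ ?_ (by positivity)
    linarith [(Nat.cast_nonneg n : (0 : ℝ) ≤ n)]
  have hηt : Tendsto η atTop (nhds 0) := tendsto_one_div_add_atTop_nhds_zero_nat
  let b : ℕ → ContDiffBump (0 : EuclideanSpace ℝ (Fin N)) := fun n =>
    { rIn := δ * η n / 2
      rOut := δ * η n
      rIn_pos := by have := hη0 n; positivity
      rIn_lt_rOut := half_lt_self (mul_pos hδ (hη0 n)) }
  have hbt : Tendsto (fun n => (b n).rOut) atTop (nhds 0) := by
    simpa using hηt.const_mul δ
  have hb2 : ∀ᶠ n in atTop, (b n).rOut ≤ 2 * (b n).rIn :=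
    Eventually.of_forall fun n => le_of_eq (by simp only [b]; ring)
  let ρ : ℕ → EuclideanSpace ℝ (Fin N) → ℝ := fun n => (b n).normed volume
  have hρs : ∀ n, ContDiff ℝ (⊤ : ℕ∞) (ρ n) := fun n => (b n).contDiff_normed
  have hρc : ∀ n, HasCompactSupport (ρ n) := fun n => (b n).hasCompactSupport_normed
  have hρ0 : ∀ n t, 0 ≤ ρ n t := fun n => (b n).nonneg_normed
  have hρK : ∀ n, ∀ x ∈ tsupport φ, ∀ t, x - t ∈ tsupport (ρ n) → t ∈ K := by
    intro n x hx t ht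
    rw [(b n).tsupport_normed_eq, mem_closedBall_zero_iff] at ht
    refine Metric.mem_cthickening_of_dist_le t x δ _ hx ?_
    rw [dist_comm, dist_eq_norm]
    exact ht.trans (mul_le_of_le_one_right hδ.le (hη1 n))
  let wn : ℕ → EuclideanSpace ℝ (Fin N) → ℝ := fun n x => ∫ t, ρ n (x - t) * W t
  let fn : ℕ → EuclideanSpace ℝ (Fin N) → ℝ := fun n x => ∫ t, ρ n (x - t) * F t
  have hwn : ∀ n, ContDiff ℝ (⊤ : ℕ∞) (wn n) := fun n =>
    contDiff_integral_sub_mul (hρs n) (hρc n) hW.locallyIntegrable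
  have hfn : ∀ n, ContDiff ℝ (⊤ : ℕ∞) (fn n) := fun n =>
    contDiff_integral_sub_mul (hρs n) (hρc n) hF.locallyIntegrable
  have hwnA : ∀ n x, |wn n x| ≤ A := fun n =>
    abs_integral_sub_mul_le (b n).integrable_normed (hρ0 n) (b n).integral_normed hA
  have hfnB : ∀ n x, |fn n x| ≤ B := fun n =>
    abs_integral_sub_mul_le (b n).integrable_normed (hρ0 n) (b n).integral_normed hB
  have hps : ∀ n, ContDiff ℝ (⊤ : ℕ∞) (fun x => smoothPosPart (η n) (wn n x)) := fun n =>
    (contDiff_smoothPosPart (hη0 n)).comp (hwn n)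
  have hpd : ∀ n, Continuous (fun x => smoothPosPartDeriv (η n) (wn n x)) := fun n =>
    (continuous_iff_continuousAt.2 fun t =>
      (hasDerivAt_smoothPosPartDeriv (hη0 n) t).continuousAt).comp (hwn n).continuous
  have hle : ∀ n, ∫ x, (-(smoothPosPart (η n) (wn n x)) * laplacian φ x +
      smoothPosPartDeriv (η n) (wn n x) * fn n x * φ x) ≤ 0 := by
    intro n
    have hi : Integrable fun x => smoothPosPartDeriv (η n) (wn n x) * fn n x * φ x :=
      (((hpd n).mul (hfn n).continuous).mul hφs.continuous).integrable_of_hasCompactSupport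
        hφc.mul_left
    rw [integral_add _ hi]
    · simp_rw [neg_mul, integral_neg]
      rw [integral_mul_laplacian (hps n) hφs hφc, neg_add_nonpos_iff]
      refine integral_mono hi (((contDiff_laplacian (hps n)).continuous.mul
        hφs.continuous).integrable_of_hasCompactSupport hφc.mul_left) fun x => ?_
      by_cases hx : x ∈ tsupport φ
      · refine mul_le_mul_of_nonneg_right ?_ (hφ0 x)
        refine le_trans (mul_le_mul_of_nonneg_left ?_ (smoothPosPartDeriv_mem_Icc _ _).1)
          (mul_laplacian_le_laplacian_comp (contDiff_smoothPosPart (hη0 n))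
            (hasDerivAt_smoothPosPart (hη0 n)) (hasDerivAt_smoothPosPartDeriv (hη0 n))
            (fun t => by positivity) (hwn n) x)
        exact le_laplacian_integral_sub_mul hw hf h hK hKΩ (hρs n) (hρc n) (hρ0 n) (hρK n x hx)
      · simp [image_eq_zero_of_notMem_tsupport hx]
    · exact ((hps n).continuous.neg.mul hLs.continuous).integrable_of_hasCompactSupport
        hLc.mul_left
  have hlim : Tendsto (fun n => ∫ x, (-(smoothPosPart (η n) (wn n x)) * laplacian φ x +
      smoothPosPartDeriv (η n) (wn n x) * fn n x * φ x)) atTop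
      (nhds (∫ x, (-(max (W x) 0) * laplacian φ x + (if 0 < W x then F x else 0) * φ x))) := by
    refine tendsto_integral_of_dominated_convergence
      (fun x => (A + 1) * |laplacian φ x| + B * |φ x|) ?_ ?_ ?_ ?_
    · intro n
      exact (((hps n).continuous.neg.mul hLs.continuous).add
        (((hpd n).mul (hfn n).continuous).mul hφs.continuous)).aestronglyMeasurable
    · exact ((hLs.continuous.integrable_of_hasCompactSupport hLc).abs.const_mul _).add
        ((hφs.continuous.integrable_of_hasCompactSupport hφc).abs.const_mul _)
    · refine fun n => Eventually.of_forall fun x => ?_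
      refine (norm_add_le _ _).trans (add_le_add ?_ ?_)
      · rw [norm_mul, norm_neg, Real.norm_eq_abs, Real.norm_eq_abs]
        refine mul_le_mul_of_nonneg_right ?_ (abs_nonneg _)
        exact (abs_smoothPosPart_le (hη0 n).le _).trans (add_le_add (hwnA n x) (hη1 n))
      · have hm := smoothPosPartDeriv_mem_Icc (η n) (wn n x)
        rw [norm_mul, norm_mul, Real.norm_of_nonneg hm.1, Real.norm_eq_abs, Real.norm_eq_abs]
        refine mul_le_mul_of_nonneg_right ?_ (abs_nonneg _)
        exact (mul_le_of_le_one_left (abs_nonneg _) hm.2).trans (hfnB n x)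
    · have hWt := ContDiffBump.ae_convolution_tendsto_right_of_locallyIntegrable
        (μ := volume) hbt hb2 hW.locallyIntegrable
      have hFt := ContDiffBump.ae_convolution_tendsto_right_of_locallyIntegrable
        (μ := volume) hbt hb2 hF.locallyIntegrable
      filter_upwards [hWt, hFt] with x hx hx'
      simp_rw [convolution_lsmul_eq_integral] at hx hx'
      exact ((tendsto_smoothPosPart hηt hx).neg.mul_const _).add
        ((tendsto_smoothPosPartDeriv_mul hηt hx hx' (hWF x)).mul_const _)
  have hfin := le_of_tendsto' hlim hle
  rw [setIntegral_eq_integral_indicator hKΩ hφK]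
  refine le_trans (le_of_eq (integral_congr_ae (Eventually.of_forall fun x => ?_))) hfin
  by_cases hx : x ∈ K <;> simp [hWdef, hFdef, hx]

end Kato

section LocallyBounded

variable {N : ℕ} {Ω : Set (EuclideanSpace ℝ (Fin N))} {u v : EuclideanSpace ℝ (Fin N) → ℝ}

lemma MemLinftyLoc.sub (hu : MemLinftyLoc Ω u) (hv : MemLinftyLoc Ω v) :
    MemLinftyLoc Ω (fun x => u x - v x) := by
  refine ⟨hu.1.sub hv.1, fun K hKΩ hK => ?_⟩
  obtain ⟨A, hA⟩ := hu.2 K hKΩ hK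
  obtain ⟨B, hB⟩ := hv.2 K hKΩ hK
  refine ⟨A + B, ?_⟩
  filter_upwards [hA, hB] with x hx hx'
  exact (abs_sub _ _).trans (add_le_add hx hx')

lemma MemLinftyLoc.max_zero (hu : MemLinftyLoc Ω u) : MemLinftyLoc Ω (fun x => max (u x) 0) := by
  refine ⟨hu.1.sup aestronglyMeasurable_const, fun K hKΩ hK => ?_⟩
  obtain ⟨A, hA⟩ := hu.2 K hKΩ hK
  refine ⟨A, ?_⟩
  filter_upwards [hA] with x hx
  rw [abs_of_nonneg (le_max_right _ _)]
  exact (max_le (le_abs_self _) (abs_nonneg _)).trans hx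

lemma MemLinftyLoc.abs_rpow (hu : MemLinftyLoc Ω u) {r : ℝ} (hr : 0 ≤ r) :
    MemLinftyLoc Ω (fun x => |u x| ^ r) := by
  refine ⟨(hu.1.aemeasurable.abs.pow_const r).aestronglyMeasurable, fun K hKΩ hK => ?_⟩
  obtain ⟨A, hA⟩ := hu.2 K hKΩ hK
  refine ⟨A ^ r, ?_⟩
  filter_upwards [hA] with x hx
  rw [abs_of_nonneg (by positivity)]
  exact Real.rpow_le_rpow (abs_nonneg _) hx hr

lemma MemLinftyLoc.mul (hu : MemLinftyLoc Ω u) (hv : MemLinftyLoc Ω v) :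
    MemLinftyLoc Ω (fun x => u x * v x) := by
  refine ⟨hu.1.mul hv.1, fun K hKΩ hK => ?_⟩
  obtain ⟨A, hA⟩ := hu.2 K hKΩ hK
  obtain ⟨B, hB⟩ := hv.2 K hKΩ hK
  refine ⟨A * B, ?_⟩
  filter_upwards [hA, hB] with x hx hx'
  rw [abs_mul]
  exact mul_le_mul hx hx' (abs_nonneg _) ((abs_nonneg _).trans hx)

lemma MemLinftyLoc.ite_pos (hu : MemLinftyLoc Ω u) (hv : MemLinftyLoc Ω v) :
    MemLinftyLoc Ω (fun x => if 0 < u x then v x else 0) := by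
  refine ⟨hv.1.indicator₀ (nullMeasurableSet_lt aemeasurable_const hu.1.aemeasurable),
    fun K hKΩ hK => ?_⟩
  obtain ⟨A, hA⟩ := hv.2 K hKΩ hK
  refine ⟨A, ?_⟩
  filter_upwards [hA] with x hx
  split_ifs
  · exact hx
  · rw [abs_zero]
    exact (abs_nonneg _).trans hx

lemma MemLinftyLoc.integrableOn (hu : MemLinftyLoc Ω u)
    {K : Set (EuclideanSpace ℝ (Fin N))} (hK : IsCompact K) (hKΩ : K ⊆ Ω) :
    IntegrableOn u K :=
  (integrable_indicator_iff hK.measurableSet).1 (hu.integrable_indicator hK hKΩ)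

lemma MemLinftyLoc.memLqLoc (hu : MemLinftyLoc Ω u) {q : ℝ} (hq : 0 ≤ q) : MemLqLoc q Ω u :=
  ⟨hu.1, fun _ hKΩ hK => (hu.abs_rpow hq).integrableOn hK hKΩ⟩

lemma MemLinftyLoc.integrableOn_mul (hu : MemLinftyLoc Ω u)
    {φ : EuclideanSpace ℝ (Fin N) → ℝ} (hφ : Continuous φ) (hc : HasCompactSupport φ)
    (hφΩ : tsupport φ ⊆ Ω) : IntegrableOn (fun x => u x * φ x) Ω := by
  have h := integrable_mul_continuous_of_hasCompactSupport
    (hu.integrable_indicator hc hφΩ) hφ hc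
  refine (h.congr (Eventually.of_forall fun x => ?_)).integrableOn
  by_cases hx : x ∈ tsupport φ
  · simp [hx]
  · simp [image_eq_zero_of_notMem_tsupport hx]

lemma MemLinftyLoc.integrableOn_weak_form (hu : MemLinftyLoc Ω u) (hv : MemLinftyLoc Ω v)
    {φ : EuclideanSpace ℝ (Fin N) → ℝ} (hφ : IsTestFun Ω φ) :
    IntegrableOn (fun x => -(u x) * laplacian φ x + v x * φ x) Ω := by
  obtain ⟨hφs, hφc, hφΩ⟩ := hφ
  have hsub : tsupport (laplacian φ) ⊆ tsupport φ :=
    closure_minimal (support_laplacian_subset φ) (isClosed_tsupport φ)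
  have h := hu.integrableOn_mul (contDiff_laplacian hφs).continuous
    (HasCompactSupport.of_support_subset_isCompact hφc (support_laplacian_subset _))
    (hsub.trans hφΩ)
  simp_rw [neg_mul]
  exact h.neg.add (hv.integrableOn_mul hφs.continuous hφc hφΩ)

end LocallyBounded

lemma abs_rpow_sub_one_mul {q a : ℝ} (hq : 0 < q) (ha : 0 ≤ a) : |a| ^ (q - 1) * a = a ^ q := by
  rw [abs_of_nonneg ha, ← Real.rpow_add_one' ha (by linarith), sub_add_cancel]

lemma max_sub_rpow_le {q a b : ℝ} (hq : 1 ≤ q) (ha : 0 ≤ a) (hb : 0 ≤ b) :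
    |max (a - b) 0| ^ (q - 1) * max (a - b) 0 ≤
      if 0 < a - b then |a| ^ (q - 1) * a - |b| ^ (q - 1) * b else 0 := by
  have hq0 : 0 < q := by linarith
  split_ifs with h
  · rw [max_eq_left h.le, abs_rpow_sub_one_mul hq0 h.le, abs_rpow_sub_one_mul hq0 ha,
      abs_rpow_sub_one_mul hq0 hb]
    have := Real.add_rpow_le_rpow_add h.le hb hq
    rw [sub_add_cancel] at this
    linarith
  · rw [max_eq_right (not_lt.1 h), mul_zero]

theorem stmt7 {N : ℕ} (hN : 2 ≤ N) (q : ℝ) (hq : ((N : ℝ) + 1) / ((N : ℝ) - 1) ≤ q)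
    (Ω : Set (EuclideanSpace ℝ (Fin N))) (hΩ : IsOpen Ω) (hΩne : Ω.Nonempty)
    (u v : EuclideanSpace ℝ (Fin N) → ℝ)
    (huloc : MemLinftyLoc Ω u) (hvloc : MemLinftyLoc Ω v)
    (hupos : ∀ᵐ x ∂(volume.restrict Ω), 0 ≤ u x)
    (hvpos : ∀ᵐ x ∂(volume.restrict Ω), 0 ≤ v x)
    (husub : IsSubsolution q Ω u) (hvsup : IsSupersolution q Ω v) :
    IsSubsolution q Ω (fun x => max (u x - v x) 0) := by
  have hq1 : 1 ≤ q := by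
    have hN' : (2 : ℝ) ≤ N := by exact_mod_cast hN
    refine le_trans ?_ hq
    rw [le_div_iff₀ (by linarith)]
    linarith
  have hw := huloc.sub hvloc
  have hgu := (huloc.abs_rpow (r := q - 1) (by linarith)).mul huloc
  have hgv := (hvloc.abs_rpow (r := q - 1) (by linarith)).mul hvloc
  have hf := hgu.sub hgv
  refine ⟨hw.max_zero.memLqLoc (by linarith), fun φ hφ hφ0 => ?_⟩
  have hsub : ∀ φ : EuclideanSpace ℝ (Fin N) → ℝ, IsTestFun Ω φ → (∀ x, 0 ≤ φ x) →
      (∫ x in Ω, (-(u x - v x) * laplacian φ x +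
        (|u x| ^ (q - 1) * u x - |v x| ^ (q - 1) * v x) * φ x)) ≤ 0 := by
    intro φ hφ hφ0
    have hu := husub.2 φ hφ hφ0
    have hv := hvsup.2 φ hφ hφ0
    have heq := integral_sub (huloc.integrableOn_weak_form hgu hφ)
      (hvloc.integrableOn_weak_form hgv hφ)
    refine le_trans (le_of_eq ?_) (heq.le.trans (by linarith))
    congr 1 with x
    ring
  have hkato := kato_inequality hΩ hw hf
    (fun x hx => by simp only [sub_eq_zero.1 hx, sub_self]) hsub hφ hφ0
  refine le_trans (integral_mono_ae (hw.max_zero.integrableOn_weak_form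
    ((hw.max_zero.abs_rpow (r := q - 1) (by linarith)).mul hw.max_zero) hφ)
    (hw.max_zero.integrableOn_weak_form (hw.ite_pos hf) hφ) ?_) hkato
  filter_upwards [hupos, hvpos] with x hux hvx
  exact add_le_add le_rfl (mul_le_mul_of_nonneg_right (max_sub_rpow_le hq1 hux hvx) (hφ0 x))
end
end

section
/- Let 𝒯 be a nonempty family of continuous nonnegative solutions of −Δu + |u|^{q−1}u = 0 in Ω. (a) If for every u₁, u₂ ∈ 𝒯 there exists v ∈ 𝒯 with max(u₁,u₂) ≤ v on Ω, then there exists a nondecreasing sequence (u_n) in 𝒯 converging pointwise on Ω to the pointwise supremum sup 𝒯, and sup 𝒯 is finite at every point, locally bounded, and is a solution of the equation in Ω. (b) If for every u₁, u₂ ∈ 𝒯 there exists v ∈ 𝒯 with v ≤ min(u₁,u₂) on Ω, then there exists a nonincreasing sequence in 𝒯 converging pointwise on Ω to the pointwise infimum inf 𝒯, and inf 𝒯 is a solution of the equation in Ω. -/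
open MeasureTheory Set Filter

noncomputable section

open scoped Topology

section MonotoneLimits

theorem exists_monotone_seq_tendsto_iSup {α ι : Type*} [TopologicalSpace α]
    [SecondCountableTopology α] [Nonempty ι] {Ω : Set α} (hΩ : IsOpen Ω) {f : ι → α → ℝ}
    (hf : ∀ i, ContinuousOn (f i) Ω)
    (hdir : ∀ i j, ∃ k, ∀ x ∈ Ω, max (f i x) (f j x) ≤ f k x)
    (hb : ∀ x ∈ Ω, BddAbove (range fun i => f i x)) :
    ∃ s : ℕ → ι, (∀ n, ∀ x ∈ Ω, f (s n) x ≤ f (s (n + 1)) x) ∧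
      ∀ x ∈ Ω, Tendsto (fun n => f (s n) x) atTop (𝓝 (⨆ i, f i x)) := by
  have hopen : ∀ (r : ℚ) (i : ι), IsOpen (Ω ∩ f i ⁻¹' Ioi (r : ℝ)) := fun r i =>
    (hf i).isOpen_inter_preimage hΩ isOpen_Ioi
  choose T hTc hT using fun r : ℚ =>
    TopologicalSpace.isOpen_iUnion_countable (fun i => Ω ∩ f i ⁻¹' Ioi (r : ℝ)) (hopen r)
  obtain ⟨i₀⟩ := ‹Nonempty ι›
  have hc : (insert i₀ (⋃ r, T r)).Countable := (countable_iUnion hTc).insert i₀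
  obtain ⟨e, he⟩ := hc.exists_eq_range (insert_nonempty _ _)
  choose k hk using hdir
  let s : ℕ → ι := fun n => Nat.rec (e 0) (fun n i => k i (e (n + 1))) n
  have hs : ∀ n, s (n + 1) = k (s n) (e (n + 1)) := fun n => rfl
  have hstep : ∀ n, ∀ x ∈ Ω, f (s n) x ≤ f (s (n + 1)) x := fun n x hx =>
    (le_max_left _ _).trans (hs n ▸ hk (s n) (e (n + 1)) x hx)
  have hle : ∀ n, ∀ x ∈ Ω, f (e n) x ≤ f (s n) x := by
    intro n x hx
    cases n with
    | zero => exact le_rfl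
    | succ n => exact (le_max_right _ _).trans (hs n ▸ hk (s n) (e (n + 1)) x hx)
  refine ⟨s, hstep, fun x hx => ?_⟩
  refine tendsto_atTop_isLUB (monotone_nat_of_le_succ fun n => hstep n x hx) ⟨?_, fun b hb' => ?_⟩
  · rintro _ ⟨n, rfl⟩
    exact le_ciSup (hb x hx) (s n)
  · have : Nonempty ι := ⟨i₀⟩
    refine ciSup_le fun i => le_of_forall_rat_lt_imp_le fun r hr => ?_
    have hmem : x ∈ ⋃ i ∈ T r, Ω ∩ f i ⁻¹' Ioi (r : ℝ) := by
      rw [hT r]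
      exact mem_iUnion.2 ⟨i, hx, hr⟩
    simp only [mem_iUnion] at hmem
    obtain ⟨j, hj, -, hjr⟩ := hmem
    have hje : j ∈ range e := he ▸ mem_insert_of_mem _ (mem_iUnion.2 ⟨r, hj⟩)
    obtain ⟨n, rfl⟩ := hje
    exact (le_of_lt (mem_preimage.1 hjr)).trans ((hle n x hx).trans (hb' ⟨n, rfl⟩))

variable {N : ℕ} {Ω : Set (EuclideanSpace ℝ (Fin N))} {q : ℝ}

theorem IsTestFun.continuous_laplacian {φ : EuclideanSpace ℝ (Fin N) → ℝ} (hφ : IsTestFun Ω φ) :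
    Continuous (laplacian φ) := by
  have h : Continuous fun x => iteratedFDeriv ℝ 2 φ x :=
    hφ.1.continuous_iteratedFDeriv (by norm_cast)
  unfold laplacian
  fun_prop

theorem laplacian_eq_zero_of_notMem_tsupport {φ : EuclideanSpace ℝ (Fin N) → ℝ}
    {x : EuclideanSpace ℝ (Fin N)} (hx : x ∉ tsupport φ) : laplacian φ x = 0 := by
  have : iteratedFDeriv ℝ 2 φ x = 0 :=
    image_eq_zero_of_notMem_tsupport fun h => hx (tsupport_iteratedFDeriv_subset 2 h)
  simp [laplacian, this]

theorem IsTestFun.hasCompactSupport_laplacian {φ : EuclideanSpace ℝ (Fin N) → ℝ}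
    (hφ : IsTestFun Ω φ) : HasCompactSupport (laplacian φ) :=
  HasCompactSupport.intro hφ.2.1 fun _ hx => laplacian_eq_zero_of_notMem_tsupport hx

theorem IsSolution.of_tendsto (hq : 1 < q) (hΩ : IsOpen Ω)
    {un : ℕ → EuclideanSpace ℝ (Fin N) → ℝ} {u : EuclideanSpace ℝ (Fin N) → ℝ}
    (hc : ∀ n, ContinuousOn (un n) Ω) (hs : ∀ n, IsSolution q Ω (un n))
    (hb : ∀ K ⊆ Ω, IsCompact K → ∃ M, ∀ n, ∀ x ∈ K, |un n x| ≤ M)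
    (ht : ∀ x ∈ Ω, Tendsto (fun n => un n x) atTop (𝓝 (u x))) : IsSolution q Ω u := by
  have hmeas : ∀ n, AEStronglyMeasurable (un n) (volume.restrict Ω) := fun n =>
    (hc n).aestronglyMeasurable hΩ.measurableSet
  have hu : AEStronglyMeasurable u (volume.restrict Ω) :=
    aestronglyMeasurable_of_tendsto_ae atTop hmeas
      ((ae_restrict_iff' hΩ.measurableSet).2 (.of_forall ht))
  refine ⟨⟨hu, fun K hK hKc => ?_⟩, fun φ hφ => ?_⟩
  · obtain ⟨M, hM⟩ := hb K hK hKc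
    have huK : AEMeasurable u (volume.restrict K) :=
      (hu.mono_measure (Measure.restrict_mono hK le_rfl)).aemeasurable
    refine IntegrableOn.of_bound hKc.measure_lt_top
      ((measurable_norm.comp_aemeasurable huK).pow_const q).aestronglyMeasurable (M ^ q) ?_
    refine (ae_restrict_iff' hKc.measurableSet).2 (.of_forall fun x hx => ?_)
    have hx' : |u x| ≤ M := le_of_tendsto (ht x (hK hx)).abs (.of_forall fun n => hM n x hx)
    rw [Real.norm_of_nonneg (by positivity)]
    exact Real.rpow_le_rpow (abs_nonneg _) hx' (by linarith)
  · obtain ⟨M, hM⟩ := hb _ hφ.2.2 hφ.2.1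
    have hφc : Continuous φ := hφ.1.continuous
    have hbound : Integrable (fun x => |M| * |laplacian φ x| + |M| ^ (q - 1) * |M| * |φ x|)
        (volume.restrict Ω) := by
      refine Integrable.integrableOn (Integrable.add ?_ ?_)
      · exact (hφ.continuous_laplacian.integrable_of_hasCompactSupport
          hφ.hasCompactSupport_laplacian).abs.const_mul _
      · exact (hφc.integrable_of_hasCompactSupport hφ.2.1).abs.const_mul _
    have hlim := tendsto_integral_of_dominated_convergence
      (F := fun n x => -(un n x) * laplacian φ x + |un n x| ^ (q - 1) * un n x * φ x)
      (f := fun x => -(u x) * laplacian φ x + |u x| ^ (q - 1) * u x * φ x) _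
      (fun n => ?_) hbound (fun n => ?_) ?_
    · simp only [(hs _).2 φ hφ] at hlim
      exact (tendsto_nhds_unique hlim tendsto_const_nhds)
    · have h1 : ContinuousOn (fun x => |un n x| ^ (q - 1)) Ω :=
        (hc n).abs.rpow_const fun x _ => Or.inr (by linarith)
      have h2 := hφ.continuous_laplacian
      exact (((hc n).neg.mul h2.continuousOn).add
        ((h1.mul (hc n)).mul hφc.continuousOn)).aestronglyMeasurable hΩ.measurableSet
    · refine .of_forall fun x => ?_
      by_cases hx : x ∈ tsupport φ
      · have h := (hM n x hx).trans (le_abs_self M)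
        refine (norm_add_le _ _).trans ?_
        simp only [norm_mul, norm_neg, Real.norm_eq_abs, Real.abs_rpow_of_nonneg (abs_nonneg _),
          abs_abs]
        have h1 : |un n x| ^ (q - 1) ≤ |M| ^ (q - 1) :=
          Real.rpow_le_rpow (abs_nonneg _) h (by linarith)
        gcongr
      · rw [laplacian_eq_zero_of_notMem_tsupport hx, image_eq_zero_of_notMem_tsupport hx]
        simp
    · refine (ae_restrict_iff' hΩ.measurableSet).2 (.of_forall fun x hx => ?_)
      have h := ht x hx
      exact (h.neg.mul_const _).add
        (((h.abs.rpow_const (Or.inr (by linarith))).mul h).mul_const _)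

end MonotoneLimits

section KellerOsserman

theorem exists_radial_profile {q : ℝ} (hq : 1 < q) :
    ∃ g : ℝ → ℝ, ContDiff ℝ (⊤ : ℕ∞) g ∧ (∀ s, 0 ≤ g s) ∧ (∀ s, 1 ≤ s → g s = 0) ∧
      (∀ s, deriv g s ≤ 0) ∧ (∃ s, 0 < s ∧ deriv g s < 0) ∧
      ∃ C, 0 < C ∧ ∀ s, 0 ≤ s → -deriv g s ≤ C * g s ^ (1 / q) := by
  obtain ⟨k, hk⟩ := exists_nat_ge (q / (q - 1))
  have hq1 : 0 < q - 1 := by linarith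
  have hk1 : (1 : ℝ) < k := lt_of_lt_of_le ((one_lt_div hq1).2 (by linarith)) hk
  have hk1' : 1 < k := by exact_mod_cast hk1
  have hkq : (k : ℝ) / q ≤ (k - 1 : ℕ) := by
    rw [Nat.cast_sub hk1'.le, div_le_iff₀ (by linarith)]
    rw [div_le_iff₀ hq1] at hk
    push_cast
    nlinarith
  set h := Real.smoothTransition with hh
  have hcd : ContDiff ℝ (⊤ : ℕ∞) h := Real.smoothTransition.contDiff
  have hd : Differentiable ℝ h := hcd.differentiable (by simp)
  have hder : ∀ s, HasDerivAt (fun s => h (1 - s) ^ k)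
      (-(k * h (1 - s) ^ (k - 1) * deriv h (1 - s))) s := by
    intro s
    have h1 : HasDerivAt (fun s : ℝ => 1 - s) (-1) s := by
      simpa using (hasDerivAt_id s).const_sub 1
    have := ((hd (1 - s)).hasDerivAt.comp s h1).pow k
    refine (this.congr_deriv (by simp [mul_assoc])).congr_of_eventuallyEq (.of_forall fun _ => rfl)
  have h0 : ∀ s, 0 ≤ h s := Real.smoothTransition.nonneg
  have h1 : ∀ s, h s ≤ 1 := Real.smoothTransition.le_one
  have hd0 : ∀ s, 0 ≤ deriv h s := fun s => Real.smoothTransition.monotone.deriv_nonneg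
  have hsmooth : ContDiff ℝ (⊤ : ℕ∞) (fun s => h (1 - s) ^ k) := by fun_prop
  refine ⟨fun s => h (1 - s) ^ k, hsmooth, fun s => pow_nonneg (h0 _) k,
    fun s hs => ?_, fun s => ?_, ?_, ?_⟩
  · simp [hh, Real.smoothTransition.zero_of_nonpos (sub_nonpos.2 hs), (zero_lt_one.trans hk1').ne']
  · rw [(hder s).deriv]
    have := h0 (1 - s); have := hd0 (1 - s)
    simp only [Left.neg_nonpos_iff]
    positivity
  · obtain ⟨c, hc, hc'⟩ := exists_deriv_eq_slope (fun s => h (1 - s) ^ k) (zero_lt_one' ℝ)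
      hsmooth.continuous.continuousOn
      (hsmooth.differentiable (by simp)).differentiableOn
    refine ⟨c, hc.1, ?_⟩
    rw [hc']
    simp [hh, Real.smoothTransition.zero_of_nonpos le_rfl, (zero_lt_one.trans hk1').ne',
      Real.smoothTransition.one_of_one_le le_rfl]
  · obtain ⟨D, hD⟩ := (isCompact_Icc (a := (0 : ℝ)) (b := 1)).exists_bound_of_continuousOn
      (hcd.continuous_deriv (by simp)).continuousOn
    have hD0 : 0 ≤ D := (norm_nonneg _).trans (hD 0 (by simp))
    refine ⟨k * (D + 1), by positivity, fun s hs => ?_⟩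
    rw [(hder s).deriv, neg_neg]
    rcases le_or_gt s 1 with hs1 | hs1
    · have hDs : deriv h (1 - s) ≤ D + 1 := by
        have := (le_abs_self _).trans (hD (1 - s) ⟨by linarith, by linarith⟩)
        linarith
      have hpow : h (1 - s) ^ (k - 1) ≤ (h (1 - s) ^ k) ^ (1 / q) := by
        rw [← Real.rpow_natCast, ← Real.rpow_natCast (h (1 - s)) k, ← Real.rpow_mul (h0 _)]
        refine Real.rpow_le_rpow_of_exponent_ge' (h0 _) (h1 _) (by positivity) ?_
        rw [mul_one_div]
        exact hkq
      have := h0 (1 - s)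
      calc k * h (1 - s) ^ (k - 1) * deriv h (1 - s)
          ≤ k * (h (1 - s) ^ k) ^ (1 / q) * (D + 1) := by
            gcongr
            exact hd0 _
        _ = _ := by ring
    · have : h (1 - s) ^ (k - 1) = 0 := by
        rw [hh, Real.smoothTransition.zero_of_nonpos (by linarith), zero_pow (by omega)]
      rw [this]
      have := h0 (1 - s)
      simp only [mul_zero, zero_mul]
      positivity

variable {N : ℕ}

theorem laplacian_comp_norm_sq {f : ℝ → ℝ} (hf : ContDiff ℝ 2 f)
    (x₀ x : EuclideanSpace ℝ (Fin N)) :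
    laplacian (fun x => f (‖x - x₀‖ ^ 2)) x =
      4 * ‖x - x₀‖ ^ 2 * deriv (deriv f) (‖x - x₀‖ ^ 2) + 2 * N * deriv f (‖x - x₀‖ ^ 2) := by
  have hd : Differentiable ℝ f := hf.differentiable (by simp)
  have hd' : Differentiable ℝ (deriv f) :=
    (ContDiff.iterate_deriv' 1 1 hf).differentiable (by simp)
  have hn : ∀ y : EuclideanSpace ℝ (Fin N),
      HasFDerivAt (fun y => ‖y - x₀‖ ^ 2) (2 • innerSL ℝ (y - x₀)) y := by
    intro y
    have := ((hasFDerivAt_id y).sub_const x₀).norm_sq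
    simpa using this
  have h1 : ∀ y, HasFDerivAt (fun x => f (‖x - x₀‖ ^ 2))
      (deriv f (‖y - x₀‖ ^ 2) • (2 • innerSL ℝ (y - x₀))) y := fun y =>
    (hd _).hasDerivAt.comp_hasFDerivAt y (hn y)
  have h1' : fderiv ℝ (fun x => f (‖x - x₀‖ ^ 2)) =
      fun y => deriv f (‖y - x₀‖ ^ 2) • (2 • innerSL ℝ (y - x₀)) := funext fun y => (h1 y).fderiv
  have hlin : HasFDerivAt (fun y : EuclideanSpace ℝ (Fin N) => 2 • innerSL ℝ (y - x₀))
      (2 • innerSL ℝ) x := by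
    have := ((innerSL ℝ (E := EuclideanSpace ℝ (Fin N))).hasFDerivAt (x := x - x₀)).comp x
      ((hasFDerivAt_id x).sub_const x₀)
    exact (this.const_smul (2 : ℕ)).congr_fderiv (by ext; simp)
  have h2 := ((hd' (‖x - x₀‖ ^ 2)).hasDerivAt.comp_hasFDerivAt x (hn x)).smul hlin
  have h2' : ∀ v, iteratedFDeriv ℝ 2 (fun x => f (‖x - x₀‖ ^ 2)) x ![v, v] =
      4 * inner ℝ (x - x₀) v ^ 2 * deriv (deriv f) (‖x - x₀‖ ^ 2) +
        2 * ‖v‖ ^ 2 * deriv f (‖x - x₀‖ ^ 2) := by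
    intro v
    have h3 := h2.fderiv
    rw [iteratedFDeriv_two_apply, h1']
    rw [show (fun y => deriv f (‖y - x₀‖ ^ 2) • (2 • innerSL ℝ (y - x₀))) =
      (deriv f ∘ fun y => ‖y - x₀‖ ^ 2) • fun y => 2 • innerSL ℝ (y - x₀) from rfl]
    rw [h3]
    simp [innerSL_apply_apply, inner_sub_left]
    rw [show ((innerSL ℝ) v) v = ‖v‖ ^ 2 from real_inner_self_eq_norm_sq v]
    ring
  simp only [laplacian, h2']
  rw [Finset.sum_add_distrib, ← Finset.sum_mul, ← Finset.mul_sum]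
  simp [EuclideanSpace.inner_single_right, EuclideanSpace.real_norm_sq_eq]
  ring

theorem isTestFun_radial {Ω : Set (EuclideanSpace ℝ (Fin N))} {g : ℝ → ℝ}
    (hg : ContDiff ℝ (⊤ : ℕ∞) g) (hg1 : ∀ s, 1 ≤ s → g s = 0) {x₀ : EuclideanSpace ℝ (Fin N)}
    {t : ℝ} (ht : 0 < t) (hΩ : Metric.closedBall x₀ t ⊆ Ω) :
    IsTestFun Ω fun x => g ((t ^ 2)⁻¹ * ‖x - x₀‖ ^ 2) := by
  have hzero : ∀ x, x ∉ Metric.closedBall x₀ t → g ((t ^ 2)⁻¹ * ‖x - x₀‖ ^ 2) = 0 := by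
    intro x hx
    apply hg1
    rw [Metric.mem_closedBall, not_le, dist_eq_norm] at hx
    rw [inv_mul_eq_div, one_le_div (by positivity)]
    gcongr
  refine ⟨?_, HasCompactSupport.intro (isCompact_closedBall x₀ t) hzero, ?_⟩
  · exact hg.comp (contDiff_const.mul ((contDiff_id.sub contDiff_const).norm_sq ℝ))
  · refine (closure_minimal (fun x hx => ?_) Metric.isClosed_closedBall).trans hΩ
    by_contra h
    exact hx (hzero x h)

theorem laplacian_radial {g : ℝ → ℝ} (hg : ContDiff ℝ (⊤ : ℕ∞) g)
    (x₀ x : EuclideanSpace ℝ (Fin N)) (c : ℝ) :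
    laplacian (fun x => g (c * ‖x - x₀‖ ^ 2)) x =
      4 * ‖x - x₀‖ ^ 2 * c ^ 2 * deriv (deriv g) (c * ‖x - x₀‖ ^ 2) +
        2 * N * c * deriv g (c * ‖x - x₀‖ ^ 2) := by
  have h1 : deriv (fun s => g (c * s)) = fun s => c * deriv g (c * s) := by
    funext s
    simpa using deriv_comp_mul_left c g s
  have h2 : ∀ s, deriv (fun s => c * deriv g (c * s)) s = c ^ 2 * deriv (deriv g) (c * s) := by
    intro s
    rw [deriv_const_mul_field, deriv_comp_mul_left c (deriv g) s]
    simp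
    ring
  have h3 : ContDiff ℝ 2 fun s => g (c * s) :=
    (hg.of_le (by norm_cast)).comp (contDiff_const.mul contDiff_id)
  rw [laplacian_comp_norm_sq h3, h1, h2]
  ring

theorem hasDerivAt_scaled_profile {g : ℝ → ℝ} (hg : ContDiff ℝ (⊤ : ℕ∞) g) (n : ℕ) (s : ℝ)
    {t : ℝ} (ht : 0 < t) :
    HasDerivAt (fun t => -2 * deriv g ((t ^ 2)⁻¹ * s) * (t ^ n)⁻¹)
      (t * (t ^ n)⁻¹ * (4 * s * ((t ^ 2)⁻¹) ^ 2 * deriv (deriv g) ((t ^ 2)⁻¹ * s) +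
        2 * n * (t ^ 2)⁻¹ * deriv g ((t ^ 2)⁻¹ * s))) t := by
  have hd : Differentiable ℝ (deriv g) :=
    ((contDiff_infty_iff_deriv.1 hg).2).differentiable (by simp)
  have h1 : HasDerivAt (fun t : ℝ => (t ^ 2)⁻¹ * s) (-(2 * t) / (t ^ 2) ^ 2 * s) t := by
    have := ((hasDerivAt_pow 2 t).inv (by positivity)).mul_const s
    simpa using this
  have h2 : HasDerivAt (fun t : ℝ => (t ^ n)⁻¹) (-(n * t ^ (n - 1)) / (t ^ n) ^ 2) t :=
    (hasDerivAt_pow n t).inv (by positivity)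
  have h3 := (((hd ((t ^ 2)⁻¹ * s)).hasDerivAt.comp t h1).const_mul (-2)).mul h2
  refine h3.congr_deriv ?_
  have h4 : (n : ℝ) * t ^ (n - 1) = n * t ^ n * t⁻¹ := by
    cases n with
    | zero => simp
    | succ n =>
      simp only [Nat.add_sub_cancel, pow_succ]
      field_simp
  rw [h4]
  simp only [Function.comp_apply]
  field_simp
  ring

theorem hasDerivAt_radial_mean {g : ℝ → ℝ} (hg : ContDiff ℝ (⊤ : ℕ∞) g)
    {K : Set (EuclideanSpace ℝ (Fin N))} (hK : IsCompact K) {u : EuclideanSpace ℝ (Fin N) → ℝ}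
    (hu : ContinuousOn u K) (x₀ : EuclideanSpace ℝ (Fin N)) {t : ℝ} (ht : 0 < t) :
    HasDerivAt (fun t => ∫ x in K, -2 * deriv g ((t ^ 2)⁻¹ * ‖x - x₀‖ ^ 2) * (t ^ N)⁻¹ * u x)
      (t * (t ^ N)⁻¹ * ∫ x in K, u x * laplacian (fun x => g ((t ^ 2)⁻¹ * ‖x - x₀‖ ^ 2)) x) t := by
  have hg1 : ContDiff ℝ (⊤ : ℕ∞) (deriv g) := (contDiff_infty_iff_deriv.1 hg).2
  have hc1 : Continuous (deriv g) := hg1.continuous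
  have hc2 : Continuous (deriv (deriv g)) := (contDiff_infty_iff_deriv.1 hg1).2.continuous
  let G : ℝ → EuclideanSpace ℝ (Fin N) → ℝ := fun t x =>
    t * (t ^ N)⁻¹ * (4 * ‖x - x₀‖ ^ 2 * ((t ^ 2)⁻¹) ^ 2 *
      deriv (deriv g) ((t ^ 2)⁻¹ * ‖x - x₀‖ ^ 2) +
        2 * N * (t ^ 2)⁻¹ * deriv g ((t ^ 2)⁻¹ * ‖x - x₀‖ ^ 2)) * u x
  have hGc : ContinuousOn (fun p : ℝ × EuclideanSpace ℝ (Fin N) => G p.1 p.2)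
      (Icc (t / 2) (2 * t) ×ˢ K) := by
    have hne : ∀ p ∈ Icc (t / 2) (2 * t) ×ˢ K, ∀ n : ℕ, p.1 ^ n ≠ 0 := by
      rintro p ⟨hp, -⟩ n
      have : 0 < p.1 := lt_of_lt_of_le (by positivity) hp.1
      positivity
    have hi : ∀ n : ℕ, ContinuousOn (fun p : ℝ × EuclideanSpace ℝ (Fin N) => (p.1 ^ n)⁻¹)
        (Icc (t / 2) (2 * t) ×ˢ K) := fun n =>
      (continuous_fst.pow n).continuousOn.inv₀ fun p hp => hne p hp n
    have hi2 := hi 2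
    have hiN := hi N
    have hs : ContinuousOn (fun p : ℝ × EuclideanSpace ℝ (Fin N) => ‖p.2 - x₀‖ ^ 2)
        (Icc (t / 2) (2 * t) ×ˢ K) := by fun_prop
    have hd1 := hc1.comp_continuousOn (hi2.mul hs)
    have hd2 := hc2.comp_continuousOn (hi2.mul hs)
    have hu2 : ContinuousOn (fun p : ℝ × EuclideanSpace ℝ (Fin N) => u p.2)
        (Icc (t / 2) (2 * t) ×ˢ K) := hu.comp continuousOn_snd fun p hp => hp.2
    exact ((continuousOn_fst.mul hiN).mul ((((continuousOn_const.mul hs).mul (hi2.pow 2)).mul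
      hd2).add ((continuousOn_const.mul hi2).mul hd1))).mul hu2
  obtain ⟨C, hC⟩ := (isCompact_Icc.prod hK).exists_bound_of_continuousOn hGc
  have hFc : ∀ t : ℝ, ContinuousOn
      (fun x => -2 * deriv g ((t ^ 2)⁻¹ * ‖x - x₀‖ ^ 2) * (t ^ N)⁻¹ * u x) K := by
    intro t
    have h : Continuous fun x : EuclideanSpace ℝ (Fin N) =>
      -2 * deriv g ((t ^ 2)⁻¹ * ‖x - x₀‖ ^ 2) * (t ^ N)⁻¹ := by fun_prop
    exact h.continuousOn.mul hu
  have hGx : ContinuousOn (G t) K :=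
    hGc.comp (f := fun x => (t, x)) (by fun_prop) fun x hx => ⟨⟨by linarith, by linarith⟩, hx⟩
  have hmain := (hasDerivAt_integral_of_dominated_loc_of_deriv_le (μ := volume.restrict K)
    (F := fun t x => -2 * deriv g ((t ^ 2)⁻¹ * ‖x - x₀‖ ^ 2) * (t ^ N)⁻¹ * u x) (F' := G)
    (bound := fun _ => C) (Icc_mem_nhds (by linarith : t / 2 < t) (by linarith : t < 2 * t))
    (.of_forall fun t => (hFc t).aestronglyMeasurable hK.measurableSet)
    ((hFc t).integrableOn_compact hK) (hGx.aestronglyMeasurable hK.measurableSet)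
    ((ae_restrict_iff' hK.measurableSet).2 (.of_forall fun x hx τ hτ => hC (τ, x) ⟨hτ, hx⟩))
    (integrableOn_const hK.measure_lt_top.ne)
    (.of_forall fun x τ hτ => (hasDerivAt_scaled_profile hg N (‖x - x₀‖ ^ 2)
      (lt_of_lt_of_le (by positivity) hτ.1)).mul_const (u x))).2
  refine hmain.congr_deriv ?_
  rw [← integral_const_mul]
  refine integral_congr_ae (.of_forall fun x => ?_)
  simp only [G, laplacian_radial hg]
  ring

theorem IsSolution.setIntegral_mul_laplacian {Ω K : Set (EuclideanSpace ℝ (Fin N))} {q : ℝ}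
    (hq : 1 < q) (hΩ : IsOpen Ω) {u φ : EuclideanSpace ℝ (Fin N) → ℝ} (hu : IsSolution q Ω u)
    (hK : IsCompact K) (hKΩ : K ⊆ Ω) (hc : ContinuousOn u K) (hpos : ∀ x ∈ K, 0 ≤ u x)
    (hφ : IsTestFun K φ) :
    ∫ x in K, u x * laplacian φ x = ∫ x in K, u x ^ q * φ x := by
  have h := hu.2 φ ⟨hφ.1, hφ.2.1, hφ.2.2.trans hKΩ⟩
  rw [setIntegral_eq_of_subset_of_forall_sdiff_eq_zero hΩ.measurableSet hKΩ] at h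
  · have h1 : IntegrableOn (fun x => u x * laplacian φ x) K :=
      (hc.mul hφ.continuous_laplacian.continuousOn).integrableOn_compact hK
    have h2 : IntegrableOn (fun x => u x ^ q * φ x) K :=
      ((hc.rpow_const fun x _ => Or.inr (by linarith)).mul
        hφ.1.continuous.continuousOn).integrableOn_compact hK
    rw [← sub_eq_zero, ← neg_eq_zero, ← integral_sub h1 h2, ← integral_neg, ← h]
    refine setIntegral_congr_fun hK.measurableSet fun x hx => ?_
    have h3 : |u x| ^ (q - 1) * u x = u x ^ q := by
      rw [abs_of_nonneg (hpos x hx)]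
      conv_lhs => rw [← Real.rpow_one (u x), ← Real.rpow_mul (hpos x hx), one_mul]
      rw [← Real.rpow_add' (hpos x hx) (by linarith), sub_add_cancel]
    simp only [h3]
    ring
  · intro x hx
    have hx' : x ∉ tsupport φ := fun h => hx.2 (hφ.2.2 h)
    rw [laplacian_eq_zero_of_notMem_tsupport hx', image_eq_zero_of_notMem_tsupport hx']
    simp

theorem setIntegral_rpow_le {α : Type*} [MeasurableSpace α] {μ : Measure α} {S : Set α}
    (hS : μ S ≠ ⊤) {q : ℝ} (hq : 1 < q) {f : α → ℝ} (hf : ∀ x, 0 ≤ f x)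
    (hm : MemLp f (ENNReal.ofReal q) (μ.restrict S)) :
    (∫ x in S, f x ∂μ) ^ q ≤ (∫ x in S, f x ^ q ∂μ) * μ.real S ^ (q - 1) := by
  have hpq := Real.HolderConjugate.conjExponent hq
  have : IsFiniteMeasure (μ.restrict S) := isFiniteMeasure_restrict.2 hS
  have h := integral_mul_le_Lp_mul_Lq_of_nonneg (μ := μ.restrict S) hpq (f := f) (g := fun _ => 1)
    (.of_forall hf) (.of_forall fun _ => zero_le_one) hm (memLp_const 1)
  simp only [mul_one, Real.one_rpow, integral_const, smul_eq_mul, measureReal_restrict_apply_univ]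
    at h
  have h0 : 0 ≤ ∫ x in S, f x ∂μ := integral_nonneg hf
  have h1 : 0 ≤ ∫ x in S, f x ^ q ∂μ := integral_nonneg fun x => Real.rpow_nonneg (hf x) q
  calc (∫ x in S, f x ∂μ) ^ q
      ≤ ((∫ x in S, f x ^ q ∂μ) ^ (1 / q) * μ.real S ^ (1 / q.conjExponent)) ^ q :=
        Real.rpow_le_rpow h0 h (by linarith)
    _ = _ := by
        rw [Real.mul_rpow (by positivity) (by positivity), ← Real.rpow_mul h1,
          ← Real.rpow_mul measureReal_nonneg, Real.conjExponent]
        congr 2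
        · rw [one_div_mul_cancel (by linarith), Real.rpow_one]
        · have : q - 1 ≠ 0 := by linarith
          field_simp

theorem mul_rpow_le_one_of_deriv_ge {q κ a b : ℝ} (hq : 1 < q) (hκ : 0 ≤ κ) (ha : 0 ≤ a)
    (hab : a ≤ b) {F F' : ℝ → ℝ} (hF : ∀ t ∈ Icc a b, HasDerivAt F (F' t) t)
    (hF0 : ∀ t ∈ Icc a b, 0 ≤ F t) (hF' : ∀ t ∈ Icc a b, κ * t * F t ^ q ≤ F' t) :
    (q - 1) * κ * (b ^ 2 - a ^ 2) / 2 * F a ^ (q - 1) ≤ 1 := by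
  rcases (hF0 a ⟨le_rfl, hab⟩).eq_or_lt with h0 | h0
  · rw [← h0, Real.zero_rpow (by linarith)]
    simp
  have hmono : MonotoneOn F (Icc a b) := by
    refine monotoneOn_of_deriv_nonneg (convex_Icc a b)
      (fun t ht => (hF t ht).continuousAt.continuousWithinAt)
      (fun t ht => (hF t (interior_subset ht)).differentiableAt.differentiableWithinAt)
      fun t ht => ?_
    have ht := interior_subset ht
    rw [(hF t ht).deriv]
    have := hF0 t ht
    have : 0 ≤ t := ha.trans ht.1
    exact le_trans (by positivity) (hF' t ht)
  have hpos : ∀ t ∈ Icc a b, 0 < F t := fun t ht =>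
    h0.trans_le (hmono ⟨le_rfl, hab⟩ ht ht.1)
  have hH : ∀ t ∈ Icc a b, HasDerivAt (fun t => F t ^ (1 - q) + (q - 1) * κ * t ^ 2 / 2)
      (F' t * (1 - q) * F t ^ (1 - q - 1) + (q - 1) * κ * t) t := by
    intro t ht
    have h1 := (hF t ht).rpow_const (p := 1 - q) (Or.inl (hpos t ht).ne')
    have h2 := ((hasDerivAt_pow 2 t).const_mul ((q - 1) * κ)).div_const 2
    refine (h1.add h2).congr_deriv ?_
    simp
    ring
  have hanti : AntitoneOn (fun t => F t ^ (1 - q) + (q - 1) * κ * t ^ 2 / 2) (Icc a b) := by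
    refine antitoneOn_of_deriv_nonpos (convex_Icc a b)
      (fun t ht => (hH t ht).continuousAt.continuousWithinAt)
      (fun t ht => (hH t (interior_subset ht)).differentiableAt.differentiableWithinAt)
      fun t ht => ?_
    have ht := interior_subset ht
    rw [(hH t ht).deriv]
    have hp := Real.rpow_pos_of_pos (hpos t ht) (1 - q - 1)
    have h1 := mul_le_mul_of_nonneg_right (hF' t ht) hp.le
    have h2 : F t ^ q * F t ^ (1 - q - 1) = 1 := by
      rw [← Real.rpow_add (hpos t ht)]
      simp
    have h3 : κ * t ≤ F' t * F t ^ (1 - q - 1) := by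
      calc κ * t = κ * t * (F t ^ q * F t ^ (1 - q - 1)) := by rw [h2, mul_one]
        _ ≤ _ := by linarith
    nlinarith
  have h := hanti ⟨le_rfl, hab⟩ ⟨hab, le_rfl⟩ hab
  simp only at h
  have hb := Real.rpow_pos_of_pos (hpos b ⟨hab, le_rfl⟩) (1 - q)
  have h1 : (q - 1) * κ * (b ^ 2 - a ^ 2) / 2 ≤ F a ^ (1 - q) := by linarith
  calc _ ≤ F a ^ (1 - q) * F a ^ (q - 1) := by
        have := hF0 a ⟨le_rfl, hab⟩
        gcongr
    _ = 1 := by rw [← Real.rpow_add h0]; simp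

theorem radial_mean_rpow_le {g : ℝ → ℝ} {q C : ℝ} (hq : 1 < q)
    (hg : ContDiff ℝ (⊤ : ℕ∞) g) (hg0 : ∀ s, 0 ≤ g s) (hg1 : ∀ s, 1 ≤ s → g s = 0)
    (hg' : ∀ s, deriv g s ≤ 0) (hC : 0 < C) (hgC : ∀ s, 0 ≤ s → -deriv g s ≤ C * g s ^ (1 / q))
    {x₀ : EuclideanSpace ℝ (Fin N)} {R t : ℝ} (ht : 0 < t) (htR : t ≤ R)
    {u : EuclideanSpace ℝ (Fin N) → ℝ} (hu : ContinuousOn u (Metric.closedBall x₀ R))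
    (hpos : ∀ x ∈ Metric.closedBall x₀ R, 0 ≤ u x) :
    (∫ x in Metric.closedBall x₀ R,
        -2 * deriv g ((t ^ 2)⁻¹ * ‖x - x₀‖ ^ 2) * (t ^ N)⁻¹ * u x) ^ q ≤
      (2 * C) ^ q * volume.real (Metric.ball (0 : EuclideanSpace ℝ (Fin N)) 1) ^ (q - 1) *
        ((t ^ N)⁻¹ * ∫ x in Metric.closedBall x₀ R, u x ^ q * g ((t ^ 2)⁻¹ * ‖x - x₀‖ ^ 2)) := by
  set B := Metric.closedBall x₀ R with hB
  set S := Metric.closedBall x₀ t with hS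
  have hSB : S ⊆ B := Metric.closedBall_subset_closedBall htR
  have hBm : MeasurableSet B := Metric.isClosed_closedBall.measurableSet
  have hSm : MeasurableSet S := Metric.isClosed_closedBall.measurableSet
  have hSc : IsCompact S := isCompact_closedBall x₀ t
  have hq0 : 0 < q := by linarith
  have hT : 0 < t ^ N := by positivity
  have hout : ∀ x ∈ B \ S, 1 ≤ (t ^ 2)⁻¹ * ‖x - x₀‖ ^ 2 := by
    intro x hx
    have hx' := hx.2
    rw [hS, Metric.mem_closedBall, not_le, dist_eq_norm] at hx'
    rw [inv_mul_eq_div, one_le_div (by positivity)]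
    gcongr
  have hd0 : ∀ s, 1 ≤ s → deriv g s = 0 := by
    intro s hs
    have h := hgC s (by linarith)
    rw [hg1 s hs, Real.zero_rpow (by positivity), mul_zero] at h
    linarith [hg' s]
  have hr : Continuous fun x : EuclideanSpace ℝ (Fin N) => (t ^ 2)⁻¹ * ‖x - x₀‖ ^ 2 := by fun_prop
  have hr0 : ∀ x : EuclideanSpace ℝ (Fin N), 0 ≤ (t ^ 2)⁻¹ * ‖x - x₀‖ ^ 2 := fun x => by positivity
  rw [setIntegral_eq_of_subset_of_forall_sdiff_eq_zero hBm hSB fun x hx => by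
      simp [hd0 _ (hout x hx)],
    setIntegral_eq_of_subset_of_forall_sdiff_eq_zero (f := fun x => u x ^ q * _) hBm hSB
      fun x hx => by simp [hg1 _ (hout x hx)]]
  have huS : ContinuousOn u S := hu.mono hSB
  have hgc : Continuous fun x : EuclideanSpace ℝ (Fin N) => g ((t ^ 2)⁻¹ * ‖x - x₀‖ ^ 2) :=
    hg.continuous.comp hr
  have hdc : Continuous fun x : EuclideanSpace ℝ (Fin N) =>
      deriv g ((t ^ 2)⁻¹ * ‖x - x₀‖ ^ 2) := (hg.continuous_deriv (by simp)).comp hr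
  set f : EuclideanSpace ℝ (Fin N) → ℝ := fun x =>
    |u x| * g ((t ^ 2)⁻¹ * ‖x - x₀‖ ^ 2) ^ (1 / q) with hf
  have hfc : ContinuousOn f S :=
    huS.abs.mul (hgc.continuousOn.rpow_const fun x _ => Or.inr (by positivity))
  have hf0 : ∀ x, 0 ≤ f x := fun x => mul_nonneg (abs_nonneg _) (Real.rpow_nonneg (hg0 _) _)
  have hfm : MemLp f (ENNReal.ofReal q) (volume.restrict S) := by
    have : IsFiniteMeasure (volume.restrict S) := isFiniteMeasure_restrict.2 hSc.measure_lt_top.ne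
    obtain ⟨M, hM⟩ := hSc.exists_bound_of_continuousOn hfc
    exact MemLp.of_bound (hfc.aestronglyMeasurable hSm) M
      ((ae_restrict_iff' hSm).2 (.of_forall hM))
  have hle : ∫ x in S, -2 * deriv g ((t ^ 2)⁻¹ * ‖x - x₀‖ ^ 2) * (t ^ N)⁻¹ * u x ≤
      2 * C * (t ^ N)⁻¹ * ∫ x in S, f x := by
    rw [← integral_const_mul]
    refine setIntegral_mono_on (ContinuousOn.integrableOn_compact hSc
      (((continuous_const.mul hdc).mul continuous_const).continuousOn.mul huS))
      ((hfc.integrableOn_compact hSc).const_mul _) hSm fun x hx => ?_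
    have h1 := hgC _ (hr0 x)
    have h2 := hpos x (hSB hx)
    simp only [hf]
    rw [abs_of_nonneg h2]
    calc _ = 2 * (-deriv g ((t ^ 2)⁻¹ * ‖x - x₀‖ ^ 2)) * ((t ^ N)⁻¹ * u x) := by ring
      _ ≤ 2 * (C * g ((t ^ 2)⁻¹ * ‖x - x₀‖ ^ 2) ^ (1 / q)) * ((t ^ N)⁻¹ * u x) := by gcongr
      _ = _ := by ring
  have hnonneg : 0 ≤ ∫ x in S, -2 * deriv g ((t ^ 2)⁻¹ * ‖x - x₀‖ ^ 2) * (t ^ N)⁻¹ * u x := by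
    refine setIntegral_nonneg hSm fun x hx => ?_
    have h1 := hg' ((t ^ 2)⁻¹ * ‖x - x₀‖ ^ 2)
    have h2 := hpos x (hSB hx)
    exact mul_nonneg (mul_nonneg (by linarith) (by positivity)) h2
  have hfq : ∫ x in S, f x ^ q = ∫ x in S, u x ^ q * g ((t ^ 2)⁻¹ * ‖x - x₀‖ ^ 2) := by
    refine setIntegral_congr_fun hSm fun x hx => ?_
    have h2 := hpos x (hSB hx)
    simp only [hf]
    rw [abs_of_nonneg h2, Real.mul_rpow h2 (Real.rpow_nonneg (hg0 _) _), ← Real.rpow_mul (hg0 _),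
      one_div_mul_cancel hq0.ne', Real.rpow_one]
  have hH := setIntegral_rpow_le hSc.measure_lt_top.ne hq hf0 hfm
  rw [hfq, hS, Measure.addHaar_real_closedBall _ _ ht.le, finrank_euclideanSpace_fin, ← hS] at hH
  have hI : 0 ≤ ∫ x in S, f x := integral_nonneg hf0
  set ω := volume.real (Metric.ball (0 : EuclideanSpace ℝ (Fin N)) 1) with hω
  have hω0 : 0 ≤ ω := measureReal_nonneg
  set J := ∫ x in S, u x ^ q * g ((t ^ 2)⁻¹ * ‖x - x₀‖ ^ 2) with hJ
  calc _ ≤ (2 * C * (t ^ N)⁻¹ * ∫ x in S, f x) ^ q := Real.rpow_le_rpow hnonneg hle hq0.le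
    _ = (2 * C) ^ q * ((t ^ N)⁻¹) ^ q * (∫ x in S, f x) ^ q := by
        rw [Real.mul_rpow (by positivity) hI, Real.mul_rpow (by positivity) (by positivity)]
    _ ≤ (2 * C) ^ q * ((t ^ N)⁻¹) ^ q * (J * (t ^ N * ω) ^ (q - 1)) := by gcongr
    _ = (2 * C) ^ q * (((t ^ N)⁻¹) ^ q * (t ^ N) ^ (q - 1)) * J * ω ^ (q - 1) := by
        rw [Real.mul_rpow hT.le hω0]
        ring
    _ = _ := by
        rw [Real.inv_rpow hT.le, ← Real.rpow_neg hT.le, ← Real.rpow_add hT,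
          show -q + (q - 1) = -1 by ring, Real.rpow_neg_one]
        ring

theorem integral_scaled_profile (f : ℝ → ℝ) (x₀ : EuclideanSpace ℝ (Fin N)) {t : ℝ} (ht : 0 < t) :
    ∫ x : EuclideanSpace ℝ (Fin N), f ((t ^ 2)⁻¹ * ‖x - x₀‖ ^ 2) * (t ^ N)⁻¹ =
      ∫ x : EuclideanSpace ℝ (Fin N), f (‖x‖ ^ 2) := by
  rw [integral_mul_const, integral_sub_right_eq_self
    (fun x : EuclideanSpace ℝ (Fin N) => f ((t ^ 2)⁻¹ * ‖x‖ ^ 2)) x₀]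
  have h := Measure.integral_comp_inv_smul (volume : Measure (EuclideanSpace ℝ (Fin N)))
    (fun x => f (‖x‖ ^ 2)) t
  rw [finrank_euclideanSpace_fin, abs_of_pos (by positivity)] at h
  have h2 : ∀ x : EuclideanSpace ℝ (Fin N), ‖t⁻¹ • x‖ ^ 2 = (t ^ 2)⁻¹ * ‖x‖ ^ 2 := by
    intro x
    rw [norm_smul, mul_pow, norm_inv, Real.norm_of_nonneg ht.le, inv_pow]
  simp only [h2] at h
  rw [h, smul_eq_mul]
  field_simp

/-- The Keller–Osserman bound for nonnegative continuous solutions. -/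
theorem exists_keller_osserman_bound [NeZero N] {q : ℝ} (hq : 1 < q) {R : ℝ} (hR : 0 < R) :
    ∃ M : ℝ, ∀ (Ω : Set (EuclideanSpace ℝ (Fin N))) (u : EuclideanSpace ℝ (Fin N) → ℝ)
      (x₀ : EuclideanSpace ℝ (Fin N)), IsOpen Ω → ContinuousOn u Ω → (∀ x ∈ Ω, 0 ≤ u x) →
      IsSolution q Ω u → Metric.closedBall x₀ R ⊆ Ω → u x₀ ≤ M := by
  obtain ⟨g, hg, hg0, hg1, hg', ⟨s, hs, hgs⟩, C, hC, hgC⟩ := exists_radial_profile hq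
  have hq0 : 0 < q := by linarith
  have hd0 : ∀ s, 1 ≤ s → deriv g s = 0 := by
    intro s hs
    have h := hgC s (by linarith)
    rw [hg1 s hs, Real.zero_rpow (by positivity), mul_zero] at h
    linarith [hg' s]
  have hdc : Continuous (deriv g) := hg.continuous_deriv (by simp)
  have hA : 0 < ∫ x : EuclideanSpace ℝ (Fin N), -2 * deriv g (‖x‖ ^ 2) := by
    refine Continuous.integral_pos_of_hasCompactSupport_nonneg_nonzero
      (x := EuclideanSpace.single 0 (√s)) (by fun_prop)
      (HasCompactSupport.intro (isCompact_closedBall 0 1) fun x hx => ?_)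
      (fun x => ?_) ?_
    · rw [Metric.mem_closedBall, not_le, dist_zero_right] at hx
      rw [hd0 _ (one_le_pow₀ hx.le), mul_zero]
    · have := hg' (‖x‖ ^ 2)
      simp only [Pi.zero_apply]
      linarith
    · simp [Real.sq_sqrt hs.le, hgs.ne]
  set A := ∫ x : EuclideanSpace ℝ (Fin N), -2 * deriv g (‖x‖ ^ 2) with hAdef
  set ω := volume.real (Metric.ball (0 : EuclideanSpace ℝ (Fin N)) 1) with hω
  have hω0 : 0 < ω := ENNReal.toReal_pos (Metric.measure_ball_pos _ _ one_pos).ne'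
    measure_ball_lt_top.ne
  set κ := ((2 * C) ^ q * ω ^ (q - 1))⁻¹ with hκ
  have hκ0 : 0 < κ := by positivity
  set L := (q - 1) * κ * R ^ 2 / 4 with hL
  have hL0 : 0 < L := by
    have : 0 < q - 1 := by linarith
    positivity
  refine ⟨2 * (L⁻¹ ^ (1 / (q - 1))) / A, fun Ω u x₀ hΩ hu hpos hsol hball => ?_⟩
  rcases (hpos x₀ (hball (Metric.mem_closedBall_self hR.le))).eq_or_lt with h0 | h0
  · rw [← h0]
    positivity
  set B := Metric.closedBall x₀ R with hB
  have hBc : IsCompact B := isCompact_closedBall x₀ R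
  have hx₀ : x₀ ∈ Ω := hball (Metric.mem_closedBall_self hR.le)
  have hev := (hu.continuousAt (hΩ.mem_nhds hx₀)).eventually (lt_mem_nhds (half_lt_self h0))
  obtain ⟨δ, hδ, hδu⟩ := Metric.eventually_nhds_iff.1 hev
  set a := min (δ / 2) (R / 2) with ha
  have ha0 : 0 < a := by positivity
  have haδ : a < δ := (min_le_left _ _).trans_lt (by linarith)
  have haR : a ≤ R / 2 := min_le_right _ _
  have hBpos : ∀ x ∈ B, 0 ≤ u x := fun x hx => hpos x (hball hx)
  have hBu : ContinuousOn u B := hu.mono hball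
  set F : ℝ → ℝ := fun t =>
    ∫ x in B, -2 * deriv g ((t ^ 2)⁻¹ * ‖x - x₀‖ ^ 2) * (t ^ N)⁻¹ * u x with hF
  have hode := mul_rpow_le_one_of_deriv_ge (F := F) (F' := fun t => t * (t ^ N)⁻¹ *
      ∫ x in B, u x * laplacian (fun x => g ((t ^ 2)⁻¹ * ‖x - x₀‖ ^ 2)) x) hq hκ0.le ha0.le
    (by linarith : a ≤ R)
    (fun t ht => hasDerivAt_radial_mean hg hBc hBu x₀ (ha0.trans_le ht.1))
    (fun t ht => setIntegral_nonneg hBc.measurableSet fun x hx => by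
      have h1 := hg' ((t ^ 2)⁻¹ * ‖x - x₀‖ ^ 2)
      have h2 := ha0.trans_le ht.1
      exact mul_nonneg (mul_nonneg (by linarith) (by positivity)) (hBpos x hx))
    (fun t ht => by
      have ht0 := ha0.trans_le ht.1
      have h1 := radial_mean_rpow_le hq hg hg0 hg1 hg' hC hgC ht0 ht.2 hBu hBpos
      rw [hsol.setIntegral_mul_laplacian hq hΩ hBc hball hBu hBpos
        (isTestFun_radial hg hg1 ht0 (Metric.closedBall_subset_closedBall ht.2))]
      calc κ * t * F t ^ q = t * (κ * F t ^ q) := by ring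
        _ ≤ t * (κ * ((2 * C) ^ q * ω ^ (q - 1) * ((t ^ N)⁻¹ *
            ∫ x in B, u x ^ q * g ((t ^ 2)⁻¹ * ‖x - x₀‖ ^ 2)))) := by gcongr
        _ = t * ((κ * ((2 * C) ^ q * ω ^ (q - 1))) * ((t ^ N)⁻¹ *
            ∫ x in B, u x ^ q * g ((t ^ 2)⁻¹ * ‖x - x₀‖ ^ 2))) := by ring
        _ = _ := by
          rw [hκ, inv_mul_cancel₀ (by positivity)]
          ring)
  have hlow : u x₀ / 2 * A ≤ F a := by
    have hzero : ∀ x, x ∉ Metric.closedBall x₀ a →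
        deriv g ((a ^ 2)⁻¹ * ‖x - x₀‖ ^ 2) = 0 := by
      intro x hx
      rw [Metric.mem_closedBall, not_le, dist_eq_norm] at hx
      refine hd0 _ ?_
      rw [inv_mul_eq_div, one_le_div (by positivity)]
      gcongr
    have hc : Continuous fun x : EuclideanSpace ℝ (Fin N) =>
        -2 * deriv g ((a ^ 2)⁻¹ * ‖x - x₀‖ ^ 2) * (a ^ N)⁻¹ := by fun_prop
    rw [hAdef, ← integral_scaled_profile (fun s => -2 * deriv g s) x₀ ha0, mul_comm,
      ← setIntegral_eq_integral_of_forall_compl_eq_zero (s := B) fun x hx => by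
        rw [hzero x fun h => hx (Metric.closedBall_subset_closedBall (by linarith) h)]
        simp,
      ← integral_mul_const]
    refine setIntegral_mono_on ((hc.mul continuous_const).continuousOn.integrableOn_compact hBc)
      ((hc.continuousOn.mul hBu).integrableOn_compact hBc) hBc.measurableSet fun x hx => ?_
    by_cases hxa : x ∈ Metric.closedBall x₀ a
    · have h1 := hg' ((a ^ 2)⁻¹ * ‖x - x₀‖ ^ 2)
      have h2 : u x₀ / 2 < u x := hδu ((Metric.mem_closedBall.1 hxa).trans_lt haδ)
      have h3 : 0 ≤ -2 * deriv g ((a ^ 2)⁻¹ * ‖x - x₀‖ ^ 2) := by linarith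
      gcongr
    · simp [hzero x hxa]
  have hFa : 0 < F a := lt_of_lt_of_le (by positivity) hlow
  have hpow : F a ^ (q - 1) ≤ L⁻¹ := by
    rw [← one_div, le_div_iff₀ hL0, mul_comm]
    refine le_trans ?_ hode
    gcongr
    rw [hL]
    have h1 : 0 ≤ (q - 1) * κ := mul_nonneg (by linarith) hκ0.le
    have h2 : R ^ 2 / 2 ≤ R ^ 2 - a ^ 2 := by nlinarith
    nlinarith
  have hFle : F a ≤ L⁻¹ ^ (1 / (q - 1)) := by
    have h := Real.rpow_le_rpow (by positivity) hpow
      (one_div_nonneg.2 (by linarith : (0 : ℝ) ≤ q - 1))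
    rwa [← Real.rpow_mul hFa.le, mul_one_div_cancel (by linarith), Real.rpow_one] at h
  rw [le_div_iff₀ hA]
  linarith

end KellerOsserman

theorem stmt9 {N : ℕ} (hN : 2 ≤ N) (q : ℝ) (hq : ((N : ℝ) + 1) / ((N : ℝ) - 1) ≤ q)
    (Ω : Set (EuclideanSpace ℝ (Fin N))) (hΩ : IsOpen Ω) (hΩne : Ω.Nonempty)
    (𝒯 : Set (EuclideanSpace ℝ (Fin N) → ℝ)) (h𝒯ne : 𝒯.Nonempty)
    (hcont : ∀ w ∈ 𝒯, ContinuousOn w Ω)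
    (hpos : ∀ w ∈ 𝒯, ∀ x ∈ Ω, 0 ≤ w x)
    (hsol : ∀ w ∈ 𝒯, IsSolution q Ω w) :
    ((∀ u₁ ∈ 𝒯, ∀ u₂ ∈ 𝒯, ∃ v ∈ 𝒯, ∀ x ∈ Ω, max (u₁ x) (u₂ x) ≤ v x) →
      (∃ un : ℕ → EuclideanSpace ℝ (Fin N) → ℝ, (∀ n, un n ∈ 𝒯) ∧
        (∀ n, ∀ x ∈ Ω, un n x ≤ un (n + 1) x) ∧
        (∀ x ∈ Ω, Tendsto (fun n => un n x) atTop
          (nhds (⨆ w : 𝒯, (w : EuclideanSpace ℝ (Fin N) → ℝ) x)))) ∧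
      (∀ x ∈ Ω, BddAbove ((fun w : EuclideanSpace ℝ (Fin N) → ℝ => w x) '' 𝒯)) ∧
      (∀ K : Set (EuclideanSpace ℝ (Fin N)), K ⊆ Ω → IsCompact K →
        ∃ M : ℝ, ∀ x ∈ K, (⨆ w : 𝒯, (w : EuclideanSpace ℝ (Fin N) → ℝ) x) ≤ M) ∧
      IsSolution q Ω (fun x => ⨆ w : 𝒯, (w : EuclideanSpace ℝ (Fin N) → ℝ) x)) ∧
    ((∀ u₁ ∈ 𝒯, ∀ u₂ ∈ 𝒯, ∃ v ∈ 𝒯, ∀ x ∈ Ω, v x ≤ min (u₁ x) (u₂ x)) →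
      (∃ un : ℕ → EuclideanSpace ℝ (Fin N) → ℝ, (∀ n, un n ∈ 𝒯) ∧
        (∀ n, ∀ x ∈ Ω, un (n + 1) x ≤ un n x) ∧
        (∀ x ∈ Ω, Tendsto (fun n => un n x) atTop
          (nhds (⨅ w : 𝒯, (w : EuclideanSpace ℝ (Fin N) → ℝ) x)))) ∧
      IsSolution q Ω (fun x => ⨅ w : 𝒯, (w : EuclideanSpace ℝ (Fin N) → ℝ) x)) := by
  have hN' : (2 : ℝ) ≤ N := by exact_mod_cast hN
  have hq1 : 1 < q := lt_of_lt_of_le ((one_lt_div (by linarith)).2 (by linarith)) hq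
  have : NeZero N := ⟨by omega⟩
  have : Nonempty 𝒯 := h𝒯ne.to_subtype
  refine ⟨fun hdir => ?_, fun hdir => ?_⟩
  · have hbound : ∀ K : Set (EuclideanSpace ℝ (Fin N)), K ⊆ Ω → IsCompact K →
        ∃ M : ℝ, ∀ w ∈ 𝒯, ∀ x ∈ K, w x ≤ M := by
      intro K hK hKc
      obtain ⟨R, hR, hRΩ⟩ := hKc.exists_cthickening_subset_open hΩ hK
      obtain ⟨M, hM⟩ := exists_keller_osserman_bound (N := N) hq1 hR
      exact ⟨M, fun w hw x hx => hM Ω w x hΩ (hcont w hw) (hpos w hw) (hsol w hw)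
        ((Metric.closedBall_subset_cthickening hx R).trans hRΩ)⟩
    have hbdd : ∀ x ∈ Ω, ∃ M : ℝ, ∀ w ∈ 𝒯, w x ≤ M := by
      intro x hx
      obtain ⟨M, hM⟩ := hbound {x} (singleton_subset_iff.2 hx) isCompact_singleton
      exact ⟨M, fun w hw => hM w hw x rfl⟩
    obtain ⟨s, hs, hlim⟩ := exists_monotone_seq_tendsto_iSup hΩ
      (f := fun w : 𝒯 => (w : EuclideanSpace ℝ (Fin N) → ℝ)) (fun w => hcont w w.2)
      (fun i j => by
        obtain ⟨v, hv, h⟩ := hdir i i.2 j j.2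
        exact ⟨⟨v, hv⟩, h⟩)
      (fun x hx => by
        obtain ⟨M, hM⟩ := hbdd x hx
        refine ⟨M, ?_⟩
        rintro _ ⟨w, rfl⟩
        exact hM w w.2)
    refine ⟨⟨fun n => s n, fun n => (s n).2, hs, hlim⟩, fun x hx => ?_, fun K hK hKc => ?_, ?_⟩
    · obtain ⟨M, hM⟩ := hbdd x hx
      refine ⟨M, ?_⟩
      rintro _ ⟨w, hw, rfl⟩
      exact hM w hw
    · obtain ⟨M, hM⟩ := hbound K hK hKc
      exact ⟨M, fun x hx => ciSup_le fun w => hM w w.2 x hx⟩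
    · refine IsSolution.of_tendsto hq1 hΩ (fun n => hcont _ (s n).2) (fun n => hsol _ (s n).2)
        (fun K hK hKc => ?_) hlim
      obtain ⟨M, hM⟩ := hbound K hK hKc
      refine ⟨M, fun n x hx => ?_⟩
      rw [abs_of_nonneg (hpos _ (s n).2 x (hK hx))]
      exact hM _ (s n).2 x hx
  · obtain ⟨s, hs, hlim⟩ := exists_monotone_seq_tendsto_iSup hΩ
      (f := fun (w : 𝒯) x => -(w : EuclideanSpace ℝ (Fin N) → ℝ) x) (fun w => (hcont w w.2).neg)
      (fun i j => by
        obtain ⟨v, hv, h⟩ := hdir i i.2 j j.2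
        refine ⟨⟨v, hv⟩, fun x hx => ?_⟩
        rw [max_neg_neg]
        exact neg_le_neg (h x hx))
      (fun x hx => by
        refine ⟨0, ?_⟩
        rintro _ ⟨w, rfl⟩
        exact neg_nonpos.2 (hpos w w.2 x hx))
    have hlim' : ∀ x ∈ Ω, Tendsto (fun n => (s n : EuclideanSpace ℝ (Fin N) → ℝ) x) atTop
        (nhds (⨅ w : 𝒯, (w : EuclideanSpace ℝ (Fin N) → ℝ) x)) := by
      intro x hx
      have h := (hlim x hx).neg
      have hneg : -(⨆ w : 𝒯, -(w : EuclideanSpace ℝ (Fin N) → ℝ) x) =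
          ⨅ w : 𝒯, (w : EuclideanSpace ℝ (Fin N) → ℝ) x := by
        rw [iInf, Real.sInf_def, iSup]
        congr 2
        ext y
        simp [neg_eq_iff_eq_neg]
      rw [hneg] at h
      simpa using h
    have hanti : ∀ n, ∀ x ∈ Ω, (s (n + 1) : EuclideanSpace ℝ (Fin N) → ℝ) x ≤
        (s n : EuclideanSpace ℝ (Fin N) → ℝ) x := fun n x hx => neg_le_neg_iff.1 (hs n x hx)
    refine ⟨⟨fun n => s n, fun n => (s n).2, hanti, hlim'⟩, ?_⟩
    refine IsSolution.of_tendsto hq1 hΩ (fun n => hcont _ (s n).2) (fun n => hsol _ (s n).2)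
      (fun K hK hKc => ?_) hlim'
    obtain ⟨M, hM⟩ := hKc.exists_bound_of_continuousOn ((hcont _ (s 0).2).mono hK)
    refine ⟨M, fun n x hx => ?_⟩
    rw [abs_of_nonneg (hpos _ (s n).2 x (hK hx))]
    have hanti_x : Antitone fun n => (s n : EuclideanSpace ℝ (Fin N) → ℝ) x :=
      antitone_nat_of_succ_le fun n => hanti n x (hK hx)
    exact (hanti_x (Nat.zero_le n)).trans ((Real.le_norm_self _).trans (hM x hx))
end
end
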